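/- arXiv:1711.04210 — 2 statements merged into one kernel-verified Lean document; each statement's English description precedes it below -/
import Mathlib

section
/- There exists a constant c > 0 such that for all x > 0: c ∫₀^{1/x} (λx)² dλ/ψ(λ) ≤ σ₀²(x) ≤ 2H(1/x), and c H(1/x) ≤ σ̂₀²(x) ≤ 2H(1/x), where H(x) = ∫₀^∞ min(1, (λ/x)²) dλ/ψ(λ). -/
open MeasureTheory Filter Set Topology

/-- The tail function of the Lévy measure ν(dx) = dx/θ(x):
    π(x) = 2∫_{1/x}^∞ dz/θ(z). -/
noncomputable def piF (θ : ℝ → ℝ) (x : ℝ) : ℝ :=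
  2 * ∫ z in Set.Ioi (1 / x), 1 / θ z

/-- The characteristic exponent ψ(λ) = ∫₀^∞ (1 − cos(xλ)) dx/θ(x). -/
noncomputable def psiF (θ : ℝ → ℝ) (l : ℝ) : ℝ :=
  ∫ x in Set.Ioi (0 : ℝ), (1 - Real.cos (x * l)) / θ x

/-- φ(x) = 2∫_{1/x}^∞ dλ/ψ(λ). -/
noncomputable def phiF (θ : ℝ → ℝ) (x : ℝ) : ℝ :=
  2 * ∫ l in Set.Ioi (1 / x), 1 / psiF θ l

/-- σ₀²(x) = (2/π)∫₀^∞ (1 − cos(λx)) dλ/ψ(λ). -/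
noncomputable def sigma0sq (θ : ℝ → ℝ) (x : ℝ) : ℝ :=
  (2 / Real.pi) * ∫ l in Set.Ioi (0 : ℝ), (1 - Real.cos (l * x)) / psiF θ l

/-- σ̂₀²(h) = sup_{|x| ≤ h} σ₀²(x). -/
noncomputable def sigma0sqHat (θ : ℝ → ℝ) (h : ℝ) : ℝ :=
  sSup (sigma0sq θ '' {x : ℝ | |x| ≤ h})

/-- H(x) = ∫₀^∞ min(1, (λ/x)²) dλ/ψ(λ). -/
noncomputable def Hfun (θ : ℝ → ℝ) (x : ℝ) : ℝ :=
  ∫ l in Set.Ioi (0 : ℝ), min 1 ((l / x) ^ 2) / psiF θ l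

/-- Standing assumptions on θ: measurability, positivity on (0,∞), and
    ∫₀^∞ min(1, x²)/θ(x) dx < ∞, so that ν(dx) = dx/θ(x) is the Lévy measure of
    a symmetric pure-jump Lévy process. -/
def ThetaOK (θ : ℝ → ℝ) : Prop :=
  Measurable θ ∧ (∀ x ∈ Set.Ioi (0 : ℝ), 0 < θ x) ∧
    MeasureTheory.IntegrableOn (fun x => min 1 (x ^ 2) / θ x) (Set.Ioi 0)

/-- Existence of local times: ∫₁^∞ dλ/ψ(λ) < ∞. -/
def PsiIntegrable (θ : ℝ → ℝ) : Prop :=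
  MeasureTheory.IntegrableOn (fun l => 1 / psiF θ l) (Set.Ioi 1)

/-- Condition (C1): 1 < α̲ ≤ ᾱ < 2, where α̲ and ᾱ are the liminf and the limsup, as
    x → 0⁺, of (x/θ(x))/ν({z : |z| ≥ x}) = (x/θ(x))/π(1/x) (which is in particular
    eventually bounded above since the limsup is finite). -/
def CondC1 (θ : ℝ → ℝ) (al ah : ℝ) : Prop :=
  1 < al ∧ al ≤ ah ∧ ah < 2 ∧
  Filter.IsBoundedUnder (· ≤ ·) (𝓝[>] (0 : ℝ))
    (fun x => (x / θ x) / piF θ (1 / x)) ∧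
  Filter.liminf (fun x => (x / θ x) / piF θ (1 / x)) (𝓝[>] (0 : ℝ)) = al ∧
  Filter.limsup (fun x => (x / θ x) / piF θ (1 / x)) (𝓝[>] (0 : ℝ)) = ah

/-- Condition (C2): 1 < β̲ ≤ β̄ < 2, where β̲ and β̄ are the liminf and the limsup, as
    x → ∞, of (x/θ(x))/ν({z : |z| ≥ x}) = (x/θ(x))/π(1/x). -/
def CondC2 (θ : ℝ → ℝ) (bl bh : ℝ) : Prop :=
  1 < bl ∧ bl ≤ bh ∧ bh < 2 ∧
  Filter.IsBoundedUnder (· ≤ ·) Filter.atTop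
    (fun x => (x / θ x) / piF θ (1 / x)) ∧
  Filter.liminf (fun x => (x / θ x) / piF θ (1 / x)) Filter.atTop = bl ∧
  Filter.limsup (fun x => (x / θ x) / piF θ (1 / x)) Filter.atTop = bh

/-- elementary facts -/
theorem aux_cos_lower (t : ℝ) (h : |t| ≤ 1) : t ^ 2 / 8 ≤ 1 - Real.cos t := by
  have h1 := Real.cos_le_one_sub_mul_cos_sq (x := t) (by linarith [Real.pi_gt_three])
  have h2 : (1:ℝ) / 8 ≤ 2 / Real.pi ^ 2 := by
    rw [div_le_div_iff₀ (by norm_num) (by positivity)]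
    nlinarith [Real.pi_gt_three, Real.pi_le_four]
  nlinarith [sq_nonneg t]

theorem aux_cos_upper (t : ℝ) : 1 - Real.cos t ≤ 2 * min 1 (t ^ 2) := by
  have h1 := Real.one_sub_sq_div_two_le_cos (x := t)
  have h2 := Real.neg_one_le_cos t
  rcases min_cases 1 (t ^ 2) with ⟨h, _⟩ | ⟨h, _⟩ <;> rw [h] <;> nlinarith [sq_nonneg t]

theorem aux_sin (t : ℝ) (ht : 0 < t) : min 1 (t ^ 2) / 40 * t ≤ t - Real.sin t := by
  by_cases h : t ≤ 2
  · have hb := Real.sin_bound (x := t / 2) (by rw [abs_of_pos (by linarith)]; linarith)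
    rw [abs_of_pos (show 0 < t / 2 by linarith)] at hb
    have hb' := (abs_le.1 hb).2
    have h2 : Real.sin t = 2 * Real.sin (t / 2) * Real.cos (t / 2) := by
      rw [← Real.sin_two_mul]; congr 1; ring
    have h3 : 0 ≤ Real.sin (t / 2) :=
      Real.sin_nonneg_of_nonneg_of_le_pi (by linarith) (by linarith [Real.pi_gt_three])
    have h4 := Real.cos_le_one (t / 2)
    have h5 : Real.sin t ≤ 2 * Real.sin (t / 2) := by rw [h2]; nlinarith
    have h6 : (t/2)^5 ≤ (t/2)^3 := by
      apply pow_le_pow_of_le_one <;> linarith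
    have h7 : min 1 (t ^ 2) ≤ t ^ 2 := min_le_right _ _
    have h8 : min 1 (t ^ 2) / 40 * t ≤ t ^ 2 / 40 * t := by gcongr
    have h9 : 0 ≤ t ^ 3 := by positivity
    nlinarith
  · have h7 : min 1 (t ^ 2) ≤ 1 := min_le_left _ _
    have := Real.sin_le_one t
    have h8 : min 1 (t ^ 2) / 40 * t ≤ 1 / 40 * t := by gcongr
    linarith

theorem aux_min_scale (l x : ℝ) : min 1 ((l * x) ^ 2) ≤ max 1 (x ^ 2) * min 1 (l ^ 2) := by
  have hx := le_max_left 1 (x ^ 2)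
  have hx' := le_max_right 1 (x ^ 2)
  rcases min_cases 1 (l ^ 2) with ⟨h, _⟩ | ⟨h, _⟩ <;> rw [h]
  · exact (min_le_left _ _).trans (by linarith)
  · refine (min_le_right _ _).trans ?_
    rw [mul_pow]; nlinarith [sq_nonneg l]

theorem aux_psi_int (θ : ℝ → ℝ) (hθ : ThetaOK θ) (l : ℝ) :
    IntegrableOn (fun x => (1 - Real.cos (x * l)) / θ x) (Ioi 0) := by
  obtain ⟨hm, hp, hi⟩ := hθ
  refine (hi.const_mul (2 * max 1 (l ^ 2))).mono' (Measurable.aestronglyMeasurable (by fun_prop)) ?_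
  refine (ae_restrict_iff' measurableSet_Ioi).2 (.of_forall fun x hx => ?_)
  have h0 := hp x hx
  rw [Real.norm_of_nonneg (div_nonneg (by linarith [Real.cos_le_one (x * l)]) h0.le),
    ← mul_div_assoc]
  gcongr
  have := aux_cos_upper (x * l)
  have := aux_min_scale x l
  linarith

theorem aux_psi_nonneg (θ : ℝ → ℝ) (hθ : ThetaOK θ) (l : ℝ) : 0 ≤ psiF θ l := by
  refine setIntegral_nonneg measurableSet_Ioi fun x hx => ?_
  exact div_nonneg (by linarith [Real.cos_le_one (x * l)]) (hθ.2.1 x hx).le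

theorem aux_psi_meas (θ : ℝ → ℝ) (hθ : ThetaOK θ) : Measurable (psiF θ) := by
  have hm := hθ.1
  have : Measurable (Function.uncurry fun l x => (1 - Real.cos (x * l)) / θ x) := by
    unfold Function.uncurry
    fun_prop
  exact (this.stronglyMeasurable.integral_prod_right).measurable

theorem aux_psi_lower (θ : ℝ → ℝ) (hθ : ThetaOK θ) :
    ∃ k : ℝ, 0 < k ∧ ∀ l ∈ Ioc (0 : ℝ) 1, k * l ^ 2 ≤ psiF θ l := by
  obtain ⟨hm, hp, hi⟩ := id hθ
  have hi1 : IntegrableOn (fun x => min 1 (x ^ 2) / θ x) (Ioc 0 1) :=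
    hi.mono_set Ioc_subset_Ioi_self
  refine ⟨(∫ x in Ioc (0:ℝ) 1, min 1 (x ^ 2) / θ x) / 8, ?_, ?_⟩
  · refine div_pos ?_ (by norm_num)
    rw [← intervalIntegral.integral_of_le zero_le_one]
    refine intervalIntegral.intervalIntegral_pos_of_pos_on
      ((intervalIntegrable_iff_integrableOn_Ioc_of_le zero_le_one).2 hi1) ?_ zero_lt_one
    intro x hx
    have := hx.1
    exact div_pos (lt_min one_pos (by positivity)) (hp x hx.1)
  · intro l hl
    have h1 : (∫ x in Ioc (0:ℝ) 1, (1 - Real.cos (x * l)) / θ x) ≤ psiF θ l := by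
      refine setIntegral_mono_set (aux_psi_int θ hθ l) ?_
        (LE.le.eventuallyLE Ioc_subset_Ioi_self)
      refine (ae_restrict_iff' measurableSet_Ioi).2 (.of_forall fun x hx => ?_)
      exact div_nonneg (by linarith [Real.cos_le_one (x * l)]) (hp x hx).le
    refine le_trans ?_ h1
    have : (∫ x in Ioc (0:ℝ) 1, min 1 (x ^ 2) / θ x) / 8 * l ^ 2
        = ∫ x in Ioc (0:ℝ) 1, l ^ 2 / 8 * (min 1 (x ^ 2) / θ x) := by
      rw [integral_const_mul]; ring
    rw [this]
    refine setIntegral_mono_on (hi1.const_mul _)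
      ((aux_psi_int θ hθ l).mono_set Ioc_subset_Ioi_self) measurableSet_Ioc fun x hx => ?_
    rw [← mul_div_assoc]
    have h0 := hp x hx.1
    gcongr
    have h2 := aux_cos_lower (x * l) (by
      rw [abs_of_nonneg (mul_nonneg hx.1.le hl.1.le)]
      exact mul_le_one₀ hx.2 hl.1.le hl.2)
    have h3 := min_le_right 1 (x ^ 2)
    rw [mul_pow] at h2
    nlinarith [sq_nonneg l]

theorem aux_H_int (θ : ℝ → ℝ) (hθ : ThetaOK θ) (hψ : PsiIntegrable θ) (x : ℝ) :
    IntegrableOn (fun l => min 1 ((l * x) ^ 2) / psiF θ l) (Ioi 0) := by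
  have hm := aux_psi_meas θ hθ
  have hn := aux_psi_nonneg θ hθ
  obtain ⟨k, hk, hk'⟩ := aux_psi_lower θ hθ
  rw [← Ioc_union_Ioi_eq_Ioi (zero_le_one (α := ℝ))]
  refine IntegrableOn.union ?_ ?_
  · refine Integrable.mono' (g := fun _ => x ^ 2 / k)
      (integrableOn_const (by simp)) (Measurable.aestronglyMeasurable (by fun_prop)) ?_
    refine (ae_restrict_iff' measurableSet_Ioc).2 (.of_forall fun l hl => ?_)
    have hl0 := hl.1
    have h1 := hk' l hl
    have h2 : 0 < psiF θ l := lt_of_lt_of_le (by positivity) h1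
    rw [Real.norm_of_nonneg (by positivity), div_le_div_iff₀ h2 hk]
    have h3 := min_le_right 1 ((l * x) ^ 2)
    calc min 1 ((l * x) ^ 2) * k ≤ (l * x) ^ 2 * k := by gcongr
      _ = x ^ 2 * (k * l ^ 2) := by ring
      _ ≤ _ := by gcongr
  · refine Integrable.mono' hψ (Measurable.aestronglyMeasurable (by fun_prop)) (.of_forall fun l => ?_)
    have := hn l
    rw [Real.norm_of_nonneg (by positivity)]
    gcongr
    exact min_le_left _ _

theorem aux_dom (θ : ℝ → ℝ) (hθ : ThetaOK θ) {x y : ℝ} (hy : |y| ≤ x) (l : ℝ) :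
    (1 - Real.cos (l * y)) / psiF θ l ≤ 2 * (min 1 ((l * x) ^ 2) / psiF θ l) := by
  have := aux_psi_nonneg θ hθ l
  rw [← mul_div_assoc]
  gcongr
  refine (aux_cos_upper _).trans ?_
  have h1 : y ^ 2 ≤ x ^ 2 := sq_le_sq' (by linarith [neg_abs_le y]) (by linarith [le_abs_self y])
  have h2 : (l * y) ^ 2 ≤ (l * x) ^ 2 := by
    rw [mul_pow, mul_pow]
    exact mul_le_mul_of_nonneg_left h1 (sq_nonneg l)
  have h3 := min_le_min_left 1 h2
  linarith

theorem aux_nonneg (θ : ℝ → ℝ) (hθ : ThetaOK θ) (y l : ℝ) :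
    0 ≤ (1 - Real.cos (l * y)) / psiF θ l :=
  div_nonneg (by linarith [Real.cos_le_one (l * y)]) (aux_psi_nonneg θ hθ l)

theorem aux_s_int (θ : ℝ → ℝ) (hθ : ThetaOK θ) (hψ : PsiIntegrable θ) (y : ℝ) :
    IntegrableOn (fun l => (1 - Real.cos (l * y)) / psiF θ l) (Ioi 0) := by
  have hm := aux_psi_meas θ hθ
  refine Integrable.mono' ((aux_H_int θ hθ hψ |y|).const_mul 2) (Measurable.aestronglyMeasurable (by fun_prop))
    (.of_forall fun l => ?_)
  rw [Real.norm_of_nonneg (aux_nonneg θ hθ y l)]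
  exact aux_dom θ hθ le_rfl l

theorem aux_pi : 2 / Real.pi ≤ 1 ∧ 1 / 2 ≤ 2 / Real.pi := by
  constructor
  · rw [div_le_one Real.pi_pos]; linarith [Real.pi_gt_three]
  · rw [div_le_div_iff₀ (by norm_num) Real.pi_pos]; linarith [Real.pi_le_four]

theorem aux_H_eq (θ : ℝ → ℝ) (x : ℝ) :
    Hfun θ (1 / x) = ∫ l in Ioi (0:ℝ), min 1 ((l * x) ^ 2) / psiF θ l := by
  simp [Hfun]

theorem aux_upper (θ : ℝ → ℝ) (hθ : ThetaOK θ) (hψ : PsiIntegrable θ) {x y : ℝ}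
    (hy : |y| ≤ x) : sigma0sq θ y ≤ 2 * Hfun θ (1 / x) := by
  rw [aux_H_eq, ← integral_const_mul]
  have h1 : (∫ l in Ioi (0:ℝ), (1 - Real.cos (l * y)) / psiF θ l) ≤
      ∫ l in Ioi (0:ℝ), 2 * (min 1 ((l * x) ^ 2) / psiF θ l) :=
    integral_mono (aux_s_int θ hθ hψ y) ((aux_H_int θ hθ hψ x).const_mul 2)
      (fun l => aux_dom θ hθ hy l)
  have h0 : 0 ≤ (∫ l in Ioi (0:ℝ), (1 - Real.cos (l * y)) / psiF θ l) :=
    integral_nonneg fun l => aux_nonneg θ hθ y l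
  unfold sigma0sq
  nlinarith [aux_pi.1]

theorem aux_lower1 (θ : ℝ → ℝ) (hθ : ThetaOK θ) (hψ : PsiIntegrable θ) {x : ℝ} (hx : 0 < x) :
    1 / 80 * (∫ l in Ioo (0 : ℝ) (1 / x), (l * x) ^ 2 / psiF θ l) ≤ sigma0sq θ x := by
  have hs := aux_s_int θ hθ hψ x
  have hb : ∀ l ∈ Ioo (0:ℝ) (1 / x), |l * x| ≤ 1 := fun l hl => by
    rw [abs_of_nonneg (mul_nonneg hl.1.le hx.le)]
    exact ((lt_div_iff₀ hx).1 hl.2).le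
  have h1 : (∫ l in Ioo (0 : ℝ) (1 / x), 1 / 8 * ((l * x) ^ 2 / psiF θ l)) ≤
      ∫ l in Ioo (0 : ℝ) (1 / x), (1 - Real.cos (l * x)) / psiF θ l := by
    refine setIntegral_mono_on ?_ (hs.mono_set Ioo_subset_Ioi_self) measurableSet_Ioo ?_
    · refine Integrable.const_mul ?_ _
      refine IntegrableOn.congr_fun ((aux_H_int θ hθ hψ x).mono_set Ioo_subset_Ioi_self)
        (fun l hl => ?_) measurableSet_Ioo
      have : (l * x) ^ 2 ≤ 1 := (sq_le_one_iff_abs_le_one _).2 (hb l hl)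
      simp only [min_eq_right this]
    · intro l hl
      have := aux_psi_nonneg θ hθ l
      rw [← mul_div_assoc]
      gcongr
      linarith [aux_cos_lower _ (hb l hl)]
  have h2 : (∫ l in Ioo (0 : ℝ) (1 / x), (1 - Real.cos (l * x)) / psiF θ l) ≤
      ∫ l in Ioi (0 : ℝ), (1 - Real.cos (l * x)) / psiF θ l :=
    setIntegral_mono_set hs (.of_forall fun l => aux_nonneg θ hθ x l)
      (LE.le.eventuallyLE Ioo_subset_Ioi_self)
  have h0 : 0 ≤ ∫ l in Ioo (0 : ℝ) (1 / x), (l * x) ^ 2 / psiF θ l :=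
    integral_nonneg fun l => div_nonneg (sq_nonneg _) (aux_psi_nonneg θ hθ l)
  rw [integral_const_mul] at h1
  unfold sigma0sq
  nlinarith [aux_pi.2]

theorem aux_lower2 (θ : ℝ → ℝ) (hθ : ThetaOK θ) (hψ : PsiIntegrable θ) {x : ℝ} (hx : 0 < x)
    {B : ℝ} (hB : ∀ y, |y| ≤ x → sigma0sq θ y ≤ B) : 1 / 80 * Hfun θ (1 / x) ≤ B := by
  have hm := aux_psi_meas θ hθ
  have hI := aux_H_int θ hθ hψ x
  have hprod : Integrable (Function.uncurry fun y l => (1 - Real.cos (l * y)) / psiF θ l)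
      ((volume.restrict (Ioc 0 x)).prod (volume.restrict (Ioi 0))) := by
    refine Integrable.mono' (g := fun p : ℝ × ℝ => 2 * (min 1 ((p.2 * x) ^ 2) / psiF θ p.2))
      ((hI.const_mul 2).comp_snd _) ?_ ?_
    · refine Measurable.aestronglyMeasurable ?_
      unfold Function.uncurry
      fun_prop
    · rw [Measure.prod_restrict]
      refine (ae_restrict_iff' (measurableSet_Ioc.prod measurableSet_Ioi)).2
        (.of_forall fun p hp => ?_)
      have h1 := hp.1
      simp only [Function.uncurry]
      rw [Real.norm_of_nonneg (aux_nonneg θ hθ _ _)]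
      exact aux_dom θ hθ (by rw [abs_of_pos h1.1]; exact h1.2) _
  have hswap := integral_integral_swap hprod
  have hL : (∫ y in Ioc 0 x, ∫ l in Ioi (0:ℝ), (1 - Real.cos (l * y)) / psiF θ l) ≤
      ∫ y in Ioc 0 x, Real.pi / 2 * B := by
    refine setIntegral_mono_on hprod.integral_prod_left (integrableOn_const (by simp))
      measurableSet_Ioc fun y hy => ?_
    have h := hB y (by rw [abs_of_pos hy.1]; exact hy.2)
    unfold sigma0sq at h
    have := Real.pi_pos
    calc _ = Real.pi / 2 * (2 / Real.pi * ∫ l in Ioi (0:ℝ), (1 - Real.cos (l * y)) / psiF θ l) := by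
          rw [← mul_assoc, div_mul_div_cancel₀ (by norm_num), div_self this.ne', one_mul]
      _ ≤ _ := by gcongr
  have hR : (∫ l in Ioi (0:ℝ), x / 40 * (min 1 ((l * x) ^ 2) / psiF θ l)) ≤
      ∫ l in Ioi (0:ℝ), ∫ y in Ioc 0 x, (1 - Real.cos (l * y)) / psiF θ l := by
    refine setIntegral_mono_on (hI.const_mul _) hprod.integral_prod_right
      measurableSet_Ioi fun l hl => ?_
    have hl0 : 0 < l := hl
    have hc : (∫ y in Ioc 0 x, (1 - Real.cos (l * y)) / psiF θ l)
        = (x - Real.sin (l * x) / l) / psiF θ l := by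
      rw [integral_div, ← intervalIntegral.integral_of_le hx.le, intervalIntegral.integral_sub
        (by simp) (Continuous.intervalIntegrable (by fun_prop) _ _),
        intervalIntegral.integral_comp_mul_left (fun y => Real.cos y) hl0.ne']
      simp
      ring
    rw [hc, ← mul_div_assoc]
    have := aux_psi_nonneg θ hθ l
    gcongr
    have h := aux_sin (l * x) (by positivity)
    have e : x - Real.sin (l * x) / l = (l * x - Real.sin (l * x)) / l := by field_simp
    rw [e, le_div_iff₀ hl0]
    linarith
  rw [integral_const_mul, ← aux_H_eq] at hR
  have hK : (∫ y in Ioc 0 x, Real.pi / 2 * B) = x * (Real.pi / 2 * B) := by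
    simp [hx.le]
  rw [hK] at hL
  have h3 : x * (Hfun θ (1 / x) / 40) ≤ x * (Real.pi / 2 * B) := by linarith
  have h4 := le_of_mul_le_mul_left h3 hx
  have hB0 : 0 ≤ B := by
    refine le_trans ?_ (hB 0 (by simp [hx.le]))
    simp [sigma0sq]
  nlinarith [Real.pi_le_four]

/-- Lemma 2.2 (Kaleta–Sztonyk): there is a constant c > 0 such that for all x > 0,
    c ∫₀^{1/x} (λx)² dλ/ψ(λ) ≤ σ₀²(x) ≤ 2H(1/x) and c H(1/x) ≤ σ̂₀²(x) ≤ 2H(1/x). -/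
theorem kaleta_sztonyk_bounds (θ : ℝ → ℝ)
    (hθ : ThetaOK θ) (hψ : PsiIntegrable θ) :
    ∃ c : ℝ, 0 < c ∧ ∀ x : ℝ, 0 < x →
      c * (∫ l in Set.Ioo (0 : ℝ) (1 / x), (l * x) ^ 2 / psiF θ l) ≤ sigma0sq θ x ∧
      sigma0sq θ x ≤ 2 * Hfun θ (1 / x) ∧
      c * Hfun θ (1 / x) ≤ sigma0sqHat θ x ∧
      sigma0sqHat θ x ≤ 2 * Hfun θ (1 / x) := by
  refine ⟨1 / 160, by norm_num, fun x hx => ?_⟩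
  have hub : ∀ y, |y| ≤ x → sigma0sq θ y ≤ 2 * Hfun θ (1 / x) :=
    fun y hy => aux_upper θ hθ hψ hy
  have hbdd : BddAbove (sigma0sq θ '' {y : ℝ | |y| ≤ x}) := by
    refine ⟨2 * Hfun θ (1 / x), ?_⟩
    rintro _ ⟨y, hy, rfl⟩
    exact hub y hy
  have hl1 := aux_lower1 θ hθ hψ hx
  have hl2 := aux_lower2 θ hθ hψ hx (B := sigma0sqHat θ x)
    fun y hy => le_csSup hbdd ⟨y, hy, rfl⟩
  have h01 : 0 ≤ ∫ l in Ioo (0 : ℝ) (1 / x), (l * x) ^ 2 / psiF θ l :=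
    integral_nonneg fun l => div_nonneg (sq_nonneg _) (aux_psi_nonneg θ hθ l)
  have h02 : 0 ≤ Hfun θ (1 / x) := by
    refine integral_nonneg fun l => div_nonneg ?_ (aux_psi_nonneg θ hθ l)
    positivity
  refine ⟨by linarith, hub x (by rw [abs_of_pos hx]), by linarith, ?_⟩
  refine csSup_le ⟨_, 0, by simp [hx.le], rfl⟩ ?_
  rintro _ ⟨y, hy, rfl⟩
  exact hub y hy
end

section
/- Assume Condition (C2). Then there exists K > 0 and finite positive constants c₀, c₁, c₂, c₃ such that for all h > K: E[sup_{|x|≤h} |η(x)|] ≤ c₀ σ̂₀(h), and for all u ≥ c₃ σ₀(h): P(sup_{|x|≤h} |η(x)| > u) ≤ c₁ exp(−u²/(c₂ σ̂₀²(h))). -/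
open MeasureTheory Filter Set Topology

/-- η is a centered Gaussian process: every finite linear combination of its values is a
    centered real Gaussian random variable. -/
def IsCenteredGaussianProcess {Ω : Type*} [MeasurableSpace Ω] (P : MeasureTheory.Measure Ω)
    (η : ℝ → Ω → ℝ) : Prop :=
  (∀ x : ℝ, Measurable (η x)) ∧
  ∀ (n : ℕ) (c x : Fin n → ℝ), ∃ v : NNReal,
    P.map (fun ω => ∑ i, c i * η (x i) ω) = ProbabilityTheory.gaussianReal 0 v

/-- η is the Gaussian process associated with the Lévy process: centered Gaussian, η(0) = 0,
    stationary increments, a.s. continuous sample paths, and variogram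
    E[(η(x) − η(y))²] = σ₀²(x − y). -/
def AssocGaussianProcess {Ω : Type*} [MeasurableSpace Ω] (P : MeasureTheory.Measure Ω)
    (θ : ℝ → ℝ) (η : ℝ → Ω → ℝ) : Prop :=
  IsCenteredGaussianProcess P η ∧
  (∀ ω, η 0 ω = 0) ∧
  (∀ s t u : ℝ, P.map (fun ω => η (s + u) ω - η (t + u) ω)
      = P.map (fun ω => η s ω - η t ω)) ∧
  (∀ᵐ ω ∂P, Continuous fun x => η x ω) ∧
  (∀ x y : ℝ, ∫ ω, (η x ω - η y ω) ^ 2 ∂P = sigma0sq θ (x - y))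

open ProbabilityTheory in
lemma gl_isGaussian {Ω : Type*} [MeasurableSpace Ω] (P : Measure Ω) [IsProbabilityMeasure P]
    {n : ℕ} (X : Fin n → Ω → ℝ) (hm : ∀ i, Measurable (X i))
    (hg : ∀ c : Fin n → ℝ, ∃ v : NNReal, P.map (fun ω => ∑ i, c i * X i ω) = gaussianReal 0 v)
    (L : StrongDual ℝ (Fin n → ℝ)) :
    ∃ v : NNReal, (P.map (fun ω i => X i ω)).map L = gaussianReal 0 v := by
  obtain ⟨v, hv⟩ := hg (fun i => L (Pi.single i 1))
  refine ⟨v, ?_⟩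
  rw [Measure.map_map (by fun_prop) (by fun_prop), ← hv]
  congr 1
  funext ω
  have : (fun i => X i ω) = ∑ i, (X i ω) • (Pi.single i (1:ℝ) : Fin n → ℝ) := by
    ext j
    simp [Finset.sum_apply, Pi.single_apply]
  simp only [Function.comp]
  rw [this, map_sum]
  simp [mul_comm]

noncomputable def glC : ENNReal :=
  .ofReal (Real.exp (ProbabilityTheory.Fernique.logRatio (9/10)))
        + ∑' n : ℕ, .ofReal (Real.exp (-2⁻¹ * Real.log ((9/10 : ENNReal) / (1 - 9/10)).toReal * 2 ^ n))

noncomputable def glγ : ℝ := ProbabilityTheory.Fernique.logRatio (9/10)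

lemma gl_half_lt : (2:ENNReal)⁻¹ < 9/10 := by
  rw [← ENNReal.toReal_lt_toReal (by simp) (ENNReal.div_ne_top (by simp) (by simp))]
  simp [ENNReal.toReal_div]; norm_num

lemma gl_lt_one : (9/10 : ENNReal) < 1 := by
  rw [← ENNReal.toReal_lt_toReal (ENNReal.div_ne_top (by simp) (by simp)) (by simp)]
  simp [ENNReal.toReal_div]; norm_num

lemma glγ_pos : 0 < glγ := ProbabilityTheory.Fernique.logRatio_pos gl_half_lt gl_lt_one

lemma glC_ne_top : glC ≠ ⊤ := by
  unfold glC
  refine ENNReal.add_ne_top.2 ⟨by simp, ?_⟩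
  have h9 : (((9/10 : ENNReal)) / (1 - 9/10)).toReal = 9 := by
    rw [ENNReal.toReal_div, ENNReal.toReal_sub_of_le gl_lt_one.le (by simp)]
    simp [ENNReal.toReal_div]; norm_num
  rw [h9]
  have hs : Summable (fun n : ℕ => Real.exp (-2⁻¹ * Real.log 9 * 2 ^ n)) := by
    have hl : 0 < 2⁻¹ * Real.log 9 := by
      have := Real.log_pos (show (1:ℝ) < 9 by norm_num); positivity
    refine Summable.of_nonneg_of_le (fun n => (Real.exp_pos _).le) (fun n => ?_)
      (Real.summable_exp_nat_mul_iff.2 (show -(2⁻¹ * Real.log 9) < 0 by linarith))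
    rw [Real.exp_le_exp]
    have : (n:ℝ) ≤ 2 ^ n := by exact_mod_cast (Nat.lt_two_pow_self (n := n)).le
    nlinarith
  rw [← ENNReal.ofReal_tsum_of_nonneg (fun n => (Real.exp_pos _).le) hs]
  simp

open ProbabilityTheory in
lemma gl_fernique_fin {Ω : Type*} [MeasurableSpace Ω] (P : Measure Ω) [IsProbabilityMeasure P]
    {n : ℕ} (X : Fin n → Ω → ℝ) (hm : ∀ i, Measurable (X i))
    (hg : ∀ c : Fin n → ℝ, ∃ v : NNReal, P.map (fun ω => ∑ i, c i * X i ω) = gaussianReal 0 v)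
    (a : ℝ) (ha : 9/10 ≤ P {ω | ‖fun i => X i ω‖ ≤ a}) :
    ∫⁻ ω, .ofReal (Real.exp (glγ * a⁻¹ ^ 2 * ‖fun i => X i ω‖ ^ 2)) ∂P ≤ glC := by
  have hmX : Measurable (fun ω i => X i ω) := by fun_prop
  set μ := P.map (fun ω i => X i ω) with hμ
  have : IsProbabilityMeasure μ := Measure.isProbabilityMeasure_map hmX.aemeasurable
  have key := gl_isGaussian P X hm hg
  have : IsGaussian μ := isGaussian_of_map_eq_gaussianReal fun L => by
    obtain ⟨v, hv⟩ := key L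
    exact ⟨0, v, hv⟩
  have h0 : ∀ L : StrongDual ℝ (Fin n → ℝ), μ[L] = 0 := by
    intro L
    obtain ⟨v, hv⟩ := key L
    have : ∫ x, x ∂(μ.map L) = 0 := by rw [hv]; simp
    rwa [integral_map (by fun_prop) (by fun_prop)] at this
  have hrot := IsGaussian.map_rotation_eq_self_of_forall_strongDual_eq_zero h0 (-(Real.pi/4))
  have hc : 9/10 ≤ μ {x | ‖x‖ ≤ a} := by
    rw [hμ, Measure.map_apply hmX (measurableSet_le (by fun_prop) (by fun_prop))]
    exact ha
  have := lintegral_exp_mul_sq_norm_le_of_map_rotation_eq_self hrot hc gl_half_lt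
  rw [hμ, lintegral_map (by fun_prop) hmX] at this
  exact this

open ProbabilityTheory in
lemma gl_fernique_nat {Ω : Type*} [MeasurableSpace Ω] (P : Measure Ω) [IsProbabilityMeasure P]
    (X : ℕ → Ω → ℝ) (hm : ∀ i, Measurable (X i))
    (hg : ∀ (n : ℕ) (k : Fin n → ℕ) (c : Fin n → ℝ), ∃ v : NNReal,
      P.map (fun ω => ∑ i, c i * X (k i) ω) = gaussianReal 0 v)
    (a : ℝ) (ha0 : 0 ≤ a) (ha : 9/10 ≤ P {ω | ∀ i, |X i ω| ≤ a}) :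
    ∫⁻ ω, ⨆ i, ENNReal.ofReal (Real.exp (glγ * a⁻¹ ^ 2 * (X i ω) ^ 2)) ∂P ≤ glC := by
  let g : ℕ → Ω → ENNReal := fun n ω =>
    ENNReal.ofReal (Real.exp (glγ * a⁻¹ ^ 2 * ‖fun i : Fin n => X i ω‖ ^ 2))
  have hγ := glγ_pos
  have hgm : ∀ n, Measurable (g n) := fun n => by
    have : Measurable (fun ω (i : Fin n) => X i ω) := by fun_prop
    fun_prop
  have hmono : Monotone g := by
    intro m n hmn ω
    dsimp only [g]
    gcongr
    rw [pi_norm_le_iff_of_nonneg (norm_nonneg _)]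
    intro i
    exact norm_le_pi_norm (fun i : Fin n => X i ω) (Fin.castLE hmn i)
  calc _ ≤ ∫⁻ ω, ⨆ n, g n ω ∂P := by
        refine lintegral_mono fun ω => iSup_le fun i => ?_
        refine le_trans ?_ (le_iSup (fun n => g n ω) (i+1))
        dsimp only [g]
        gcongr ENNReal.ofReal (Real.exp (_ * ?_))
        rw [← sq_abs]
        gcongr
        exact norm_le_pi_norm (fun j : Fin (i+1) => X j ω) (Fin.last i)
    _ = ⨆ n, ∫⁻ ω, g n ω ∂P := lintegral_iSup hgm hmono
    _ ≤ glC := by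
        refine iSup_le fun n => ?_
        refine gl_fernique_fin P (fun i : Fin n => X i) (fun i => hm i) (fun c => hg n _ c) a ?_
        refine ha.trans (measure_mono fun ω hω => ?_)
        show ‖_‖ ≤ a
        rw [pi_norm_le_iff_of_nonneg ha0]
        exact fun i => hω i

open ProbabilityTheory in
lemma gl_fernique {Ω ι : Type*} [MeasurableSpace Ω] (P : Measure Ω) [IsProbabilityMeasure P]
    [Countable ι] [Nonempty ι]
    (X : ι → Ω → ℝ) (hm : ∀ i, Measurable (X i))
    (hg : ∀ (n : ℕ) (k : Fin n → ι) (c : Fin n → ℝ), ∃ v : NNReal,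
      P.map (fun ω => ∑ i, c i * X (k i) ω) = gaussianReal 0 v)
    (a : ℝ) (ha0 : 0 ≤ a) (ha : 9/10 ≤ P {ω | ∀ i, |X i ω| ≤ a}) :
    ∫⁻ ω, ⨆ i, ENNReal.ofReal (Real.exp (glγ * a⁻¹ ^ 2 * (X i ω) ^ 2)) ∂P ≤ glC := by
  obtain ⟨f, hf⟩ := exists_surjective_nat ι
  have := gl_fernique_nat P (fun n => X (f n)) (fun n => hm _) (fun n k c => hg n (fun i => f (k i)) c)
    a ha0 (ha.trans (measure_mono fun ω hω i => hω _))
  refine le_trans (le_of_eq ?_) this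
  congr 1
  funext ω
  exact (hf.iSup_comp (fun i => ENNReal.ofReal (Real.exp (glγ * a⁻¹ ^ 2 * (X i ω) ^ 2)))).symm

open ProbabilityTheory in
lemma gl_inc_gauss {Ω : Type*} [MeasurableSpace Ω] {P : Measure Ω} {η : ℝ → Ω → ℝ}
    (hη : IsCenteredGaussianProcess P η) (s : ℝ) (n : ℕ) (c x : Fin n → ℝ) :
    ∃ v : NNReal, P.map (fun ω => ∑ i, c i * (η (s + x i) ω - η s ω)) = gaussianReal 0 v := by
  obtain ⟨v, hv⟩ := hη.2 (n+1) (Fin.cons (-∑ i, c i) c) (Fin.cons s (fun i => s + x i))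
  refine ⟨v, ?_⟩
  rw [← hv]
  congr 1
  funext ω
  simp only [Fin.sum_univ_succ, Fin.cons_zero, Fin.cons_succ, mul_sub, Finset.sum_sub_distrib,
    neg_mul, Finset.sum_mul]
  ring

open ProbabilityTheory in
lemma gl_inc_gauss1 {Ω : Type*} [MeasurableSpace Ω] {P : Measure Ω} {η : ℝ → Ω → ℝ}
    (hη : IsCenteredGaussianProcess P η) (s x : ℝ) :
    ∃ v : NNReal, P.map (fun ω => (η (s + x) ω - η s ω)) = gaussianReal 0 v := by
  obtain ⟨v, hv⟩ := gl_inc_gauss hη s 1 (fun _ => 1) (fun _ => x)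
  exact ⟨v, by simpa using hv⟩

open ProbabilityTheory in
lemma gl_memLp {Ω : Type*} [MeasurableSpace Ω] {P : Measure Ω} {X : Ω → ℝ} (hX : Measurable X)
    {v : NNReal} (h : P.map X = gaussianReal 0 v) : MemLp X 2 P := by
  have : MemLp id 2 (P.map X) := by rw [h]; exact memLp_id_gaussianReal 2
  exact (memLp_map_measure_iff (by fun_prop) hX.aemeasurable).1 this

open ProbabilityTheory in
lemma gl_var {Ω : Type*} [MeasurableSpace Ω] {P : Measure Ω} {X : Ω → ℝ} (hX : Measurable X)
    {v : NNReal} (h : P.map X = gaussianReal 0 v) : ∫ ω, X ω ^ 2 ∂P = v := by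
  have h1 : ∫ x, x ^ 2 ∂(P.map X) = v := by
    rw [h]
    have := variance_fun_id_gaussianReal (μ := 0) (v := v)
    rw [variance_of_integral_eq_zero (by fun_prop) (by simp)] at this
    exact this
  rwa [integral_map hX.aemeasurable (by fun_prop)] at h1

open ProbabilityTheory in
lemma gl_inc_second {Ω : Type*} [MeasurableSpace Ω] {P : Measure Ω} {η : ℝ → Ω → ℝ}
    (hη : IsCenteredGaussianProcess P η) (f : ℝ → ℝ)
    (hf : ∀ x y : ℝ, ∫ ω, (η x ω - η y ω) ^ 2 ∂P = f (x - y))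
    (s : ℝ) (n : ℕ) (c x : Fin n → ℝ) :
    ∫ ω, (∑ i, c i * (η (s + x i) ω - η s ω)) ^ 2 ∂P =
      ∑ i, ∑ j, c i * c j * ((f (x i) + f (x j) - f (x i - x j)) / 2) := by
  have hm : ∀ i, Measurable (fun ω => η (s + x i) ω - η s ω) := fun i =>
    (hη.1 _).sub (hη.1 _)
  have hL : ∀ i, MemLp (fun ω => η (s + x i) ω - η s ω) 2 P := fun i => by
    obtain ⟨v, hv⟩ := gl_inc_gauss1 hη s (x i)
    exact gl_memLp (hm i) hv
  have hij : ∀ i j, Integrable (fun ω => (η (s + x i) ω - η s ω) * (η (s + x j) ω - η s ω)) P :=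
    fun i j => (hL i).integrable_mul (hL j)
  have hcov : ∀ i j, ∫ ω, (η (s + x i) ω - η s ω) * (η (s + x j) ω - η s ω) ∂P
      = (f (x i) + f (x j) - f (x i - x j)) / 2 := by
    intro i j
    have e : ∀ ω, (η (s + x i) ω - η s ω) * (η (s + x j) ω - η s ω) =
      ((η (s + x i) ω - η s ω)^2 + (η (s + x j) ω - η s ω)^2
        - (η (s + x i) ω - η (s + x j) ω)^2) / 2 := fun ω => by ring
    have h3 : Integrable (fun ω => (η (s + x i) ω - η (s + x j) ω)^2) P := by
      have := ((hL i).sub (hL j)).integrable_sq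
      refine this.congr (Eventually.of_forall fun ω => ?_)
      simp
    have h12 : Integrable (fun ω => (η (s + x i) ω - η s ω)^2 + (η (s + x j) ω - η s ω)^2) P :=
      (hL i).integrable_sq.add (hL j).integrable_sq
    simp_rw [e]
    rw [integral_div, integral_sub h12 h3,
      integral_add (hL i).integrable_sq (hL j).integrable_sq, hf, hf, hf]
    congr 3 <;> ring_nf
  have e : ∀ ω, (∑ i, c i * (η (s + x i) ω - η s ω)) ^ 2 =
      ∑ i, ∑ j, c i * c j * ((η (s + x i) ω - η s ω) * (η (s + x j) ω - η s ω)) := by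
    intro ω
    rw [sq, Finset.sum_mul_sum]
    refine Finset.sum_congr rfl fun i _ => Finset.sum_congr rfl fun j _ => by ring
  simp_rw [e]
  rw [integral_finsetSum _ (fun i _ => integrable_finsetSum _ fun j _ => (hij i j).const_mul _)]
  refine Finset.sum_congr rfl fun i _ => ?_
  rw [integral_finsetSum _ (fun j _ => (hij i j).const_mul _)]
  refine Finset.sum_congr rfl fun j _ => ?_
  rw [integral_const_mul, hcov]

open ProbabilityTheory in
lemma gl_inc_law {Ω : Type*} [MeasurableSpace Ω] {P : Measure Ω} [IsProbabilityMeasure P]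
    {η : ℝ → Ω → ℝ}
    (hη : IsCenteredGaussianProcess P η) (f : ℝ → ℝ)
    (hf : ∀ x y : ℝ, ∫ ω, (η x ω - η y ω) ^ 2 ∂P = f (x - y))
    (s t : ℝ) (n : ℕ) (x : Fin n → ℝ) :
    P.map (fun ω i => η (s + x i) ω - η s ω) = P.map (fun ω i => η (t + x i) ω - η t ω) := by
  have hm : ∀ s i, Measurable (fun ω => η (s + x i) ω - η s ω) := fun s i =>
    (hη.1 _).sub (hη.1 _)
  have hm' : ∀ s, Measurable (fun ω (i : Fin n) => η (s + x i) ω - η s ω) := fun s =>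
    measurable_pi_iff.2 (hm s)
  have : ∀ s, IsProbabilityMeasure (P.map (fun ω (i : Fin n) => η (s + x i) ω - η s ω)) := fun s =>
    Measure.isProbabilityMeasure_map (hm' s).aemeasurable
  refine Measure.ext_of_charFunDual ?_
  ext L
  rw [charFunDual_eq_charFun_map_one, charFunDual_eq_charFun_map_one]
  have key : ∀ s, ((P.map (fun ω (i : Fin n) => η (s + x i) ω - η s ω)).map L) = gaussianReal 0
      (∑ i, ∑ j, L (Pi.single i 1) * L (Pi.single j 1)
        * ((f (x i) + f (x j) - f (x i - x j)) / 2)).toNNReal := by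
    intro s
    obtain ⟨v, hv⟩ := gl_isGaussian P (fun i ω => η (s + x i) ω - η s ω) (hm s)
      (fun c => gl_inc_gauss hη s n c x) L
    rw [hv]
    congr 1
    rw [Measure.map_map (by fun_prop) (hm' s)] at hv
    have h2 := gl_var (by have := hm' s; fun_prop) hv
    have e : ∀ ω, (L ∘ fun ω (i : Fin n) => η (s + x i) ω - η s ω) ω =
        ∑ i, L (Pi.single i 1) * (η (s + x i) ω - η s ω) := by
      intro ω
      have : (fun i => η (s + x i) ω - η s ω) =
          ∑ i, (η (s + x i) ω - η s ω) • (Pi.single i (1:ℝ) : Fin n → ℝ) := by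
        ext j
        simp [Finset.sum_apply, Pi.single_apply]
      simp only [Function.comp]
      rw [this, map_sum]
      simp only [map_smul, smul_eq_mul, mul_comm]
    simp_rw [e] at h2
    rw [gl_inc_second hη f hf] at h2
    rw [h2]; simp
  rw [key s, key t]

lemma gl_quantile_shift {Ω : Type*} [MeasurableSpace Ω] {P : Measure Ω} [IsProbabilityMeasure P]
    {η : ℝ → Ω → ℝ}
    (hη : IsCenteredGaussianProcess P η) (f : ℝ → ℝ)
    (hf : ∀ x y : ℝ, ∫ ω, (η x ω - η y ω) ^ 2 ∂P = f (x - y))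
    (s t : ℝ) {ι : Type*} [Countable ι] [Nonempty ι] (x : ι → ℝ) (a : ℝ) (b : ENNReal)
    (h : b ≤ P {ω | ∀ i, |η (t + x i) ω - η t ω| ≤ a}) :
    b ≤ P {ω | ∀ i, |η (s + x i) ω - η s ω| ≤ a} := by
  obtain ⟨g, hg⟩ := exists_surjective_nat ι
  have hset : ∀ s, {ω | ∀ i, |η (s + x i) ω - η s ω| ≤ a} =
      ⋂ n : ℕ, {ω | ∀ i : Fin n, |η (s + x (g i)) ω - η s ω| ≤ a} := by
    intro s
    ext ω
    simp only [mem_ofPred_eq, mem_iInter]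
    refine ⟨fun h n i => h _, fun h i => ?_⟩
    obtain ⟨k, rfl⟩ := hg i
    exact h (k+1) (Fin.last k)
  have hm' : ∀ s n, Measurable (fun ω (i : Fin n) => η (s + x (g i)) ω - η s ω) := fun s n =>
    measurable_pi_iff.2 (fun i => (hη.1 _).sub (hη.1 _))
  have hT : ∀ n, MeasurableSet {y : Fin n → ℝ | ∀ i, |y i| ≤ a} := by
    intro n
    rw [show {y : Fin n → ℝ | ∀ i, |y i| ≤ a} = ⋂ i, {y | |y i| ≤ a} by ext; simp]
    exact MeasurableSet.iInter fun i => measurableSet_le (by fun_prop) (by fun_prop)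
  have hmeas : ∀ s (n : ℕ), MeasurableSet {ω | ∀ i : Fin n, |η (s + x (g i)) ω - η s ω| ≤ a} :=
    fun s n => hm' s n (hT n)
  have heq : ∀ n : ℕ, P {ω | ∀ i : Fin n, |η (s + x (g i)) ω - η s ω| ≤ a} =
      P {ω | ∀ i : Fin n, |η (t + x (g i)) ω - η t ω| ≤ a} := by
    intro n
    have := congrArg (fun μ => μ {y : Fin n → ℝ | ∀ i, |y i| ≤ a})
      (gl_inc_law hη f hf s t n (fun i => x (g i)))
    rwa [Measure.map_apply (hm' s n) (hT n), Measure.map_apply (hm' t n) (hT n)] at this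
  rw [hset s, Antitone.measure_iInter]
  · refine le_iInf fun n => ?_
    rw [heq]
    refine h.trans (measure_mono ?_)
    rw [hset t]
    exact iInter_subset _ n
  · intro m n hmn ω hω i
    exact hω (Fin.castLE hmn i)
  · exact fun n => (hmeas s n).nullMeasurableSet
  · exact ⟨0, measure_ne_top _ _⟩

open ProbabilityTheory in
lemma gl_fourth {Ω : Type*} [MeasurableSpace Ω] {P : Measure Ω} {X : Ω → ℝ} (hX : Measurable X)
    {v : NNReal} (h : P.map X = gaussianReal 0 v) :
    ∫⁻ ω, ENNReal.ofReal (X ω ^ 4) ∂P =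
      ENNReal.ofReal ((v:ℝ)^2) * ∫⁻ x, ENNReal.ofReal (x ^ 4) ∂(gaussianReal 0 1) := by
  have h1 : gaussianReal 0 v = (gaussianReal 0 1).map (Real.sqrt v * ·) := by
    rw [gaussianReal_map_const_mul]
    congr 1
    · simp
    · ext; simp
  rw [← lintegral_map (f := fun x => ENNReal.ofReal (x^4)) (by fun_prop) hX, h, h1,
    lintegral_map (by fun_prop) (by fun_prop), ← lintegral_const_mul _ (by fun_prop)]
  congr 1
  funext x
  rw [← ENNReal.ofReal_mul (by positivity), mul_pow]
  congr 2
  rw [show 4 = 2 * 2 by norm_num, pow_mul, Real.sq_sqrt v.coe_nonneg]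

open ProbabilityTheory in
lemma gl_kappa : ∫⁻ x, ENNReal.ofReal (x ^ 4) ∂(gaussianReal 0 1) ≠ ⊤ := by
  have h : MemLp id 4 (gaussianReal 0 1) := memLp_id_gaussianReal 4
  have h2 : Integrable (fun x : ℝ => x ^ 4) (gaussianReal 0 1) := by
    have := h.integrable_norm_pow (p := 4) (by norm_num)
    refine this.congr (Eventually.of_forall fun x => ?_)
    simp only [id, Real.norm_eq_abs]
    exact Even.pow_abs (by decide) x
  exact h2.lintegral_lt_top.ne

abbrev glD (N : ℕ) : Type := {q : ℚ // 0 ≤ q ∧ q ≤ 2 ^ N}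

lemma glD_nonempty (N : ℕ) : Nonempty (glD N) := ⟨⟨0, le_refl _, by positivity⟩⟩

noncomputable def glS {Ω : Type*} (η : ℝ → Ω → ℝ) (s : ℝ) (N : ℕ) (ω : Ω) : ENNReal :=
  ⨆ q : glD N, ENNReal.ofReal ((η (s + (q.1 : ℝ)) ω - η s ω) ^ 4)

lemma glS_meas {Ω : Type*} [MeasurableSpace Ω] {P : Measure Ω} {η : ℝ → Ω → ℝ}
    (hη : IsCenteredGaussianProcess P η) (s : ℝ) (N : ℕ) : Measurable (glS η s N) := by
  unfold glS
  refine Measurable.iSup fun q => ?_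
  exact (((hη.1 _).sub (hη.1 _)).pow_const 4).ennreal_ofReal

lemma gl_base_quantile {Ω : Type*} [MeasurableSpace Ω] {P : Measure Ω} [IsProbabilityMeasure P]
    {η : ℝ → Ω → ℝ} (hη : IsCenteredGaussianProcess P η)
    (hc : ∀ᵐ ω ∂P, Continuous fun x => η x ω) :
    ∃ a : ℝ, 0 < a ∧ 9/10 ≤ P {ω | ∀ q : glD 0, |η (0 + (q.1:ℝ)) ω - η 0 ω| ≤ a} := by
  have hne := glD_nonempty 0
  set A : ℕ → Set Ω := fun n => {ω | ∀ q : glD 0, |η (0 + (q.1:ℝ)) ω - η 0 ω| ≤ (n:ℝ) + 1} with hA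
  have hmono : Monotone A := by
    intro m n hmn ω hω q
    have : (m:ℝ) ≤ n := by exact_mod_cast hmn
    exact (hω q).trans (by linarith)
  have h1 : P (⋃ n, A n) = 1 := by
    rw [← measure_univ (μ := P)]
    refine measure_congr (eventuallyEq_univ.2 ?_)
    filter_upwards [hc] with ω hω
    have hb : BddAbove ((fun x => |η (0 + x) ω - η 0 ω|) '' Icc 0 1) :=
      isCompact_Icc.bddAbove_image (by fun_prop)
    obtain ⟨M, hM⟩ := hb
    obtain ⟨n, hn⟩ := exists_nat_ge M
    rw [mem_iUnion]
    refine ⟨n, fun q => ?_⟩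
    have : |η (0 + (q.1:ℝ)) ω - η 0 ω| ≤ M := by
      refine hM ⟨(q.1:ℝ), ⟨by exact_mod_cast q.2.1, ?_⟩, rfl⟩
      have h2 : q.1 ≤ 1 := by
        have := q.2.2
        have h1 := pow_zero (2:ℚ)
        linarith
      exact_mod_cast h2
    linarith
  have ht := tendsto_measure_iUnion_atTop (μ := P) hmono
  rw [h1] at ht
  have := ht.eventually (lt_mem_nhds gl_lt_one)
  obtain ⟨n, hn⟩ := this.exists
  exact ⟨n + 1, by positivity, hn.le⟩

lemma gl_base {Ω : Type*} [MeasurableSpace Ω] {P : Measure Ω} [IsProbabilityMeasure P]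
    {η : ℝ → Ω → ℝ} (hη : IsCenteredGaussianProcess P η) (f : ℝ → ℝ)
    (hf : ∀ x y : ℝ, ∫ ω, (η x ω - η y ω) ^ 2 ∂P = f (x - y))
    (hc : ∀ᵐ ω ∂P, Continuous fun x => η x ω) :
    ∃ B : ENNReal, B ≠ ⊤ ∧ ∀ s, ∫⁻ ω, glS η s 0 ω ∂P ≤ B := by
  have hne := glD_nonempty 0
  obtain ⟨a, ha, hq⟩ := gl_base_quantile hη hc
  have hγ := glγ_pos
  set r := glγ * a⁻¹ ^ 2 with hr
  have hrpos : 0 < r := by positivity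
  refine ⟨ENNReal.ofReal (2 / r ^ 2) * glC, ENNReal.mul_ne_top (by simp) glC_ne_top, fun s => ?_⟩
  have hs := gl_quantile_shift hη f hf s 0 (fun q : glD 0 => (q.1:ℝ)) a _ hq
  have := gl_fernique P (fun (q : glD 0) ω => η (s + (q.1:ℝ)) ω - η s ω)
    (fun q => (hη.1 _).sub (hη.1 _)) (fun n k c => gl_inc_gauss hη s n c _) a ha.le hs
  calc _ ≤ ∫⁻ ω, ENNReal.ofReal (2 / r ^ 2) *
        ⨆ q : glD 0, ENNReal.ofReal (Real.exp (r * (η (s + (q.1:ℝ)) ω - η s ω) ^ 2)) ∂P := by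
        refine lintegral_mono fun ω => ?_
        refine iSup_le fun q => ?_
        rw [ENNReal.mul_iSup]
        refine le_trans ?_ (le_iSup _ q)
        rw [← ENNReal.ofReal_mul (by positivity)]
        refine ENNReal.ofReal_le_ofReal ?_
        set y := η (s + (q.1:ℝ)) ω - η s ω
        have h2 := Real.quadratic_le_exp_of_nonneg (show 0 ≤ r * y ^ 2 by positivity)
        have h3 : (r * y^2)^2 / 2 ≤ Real.exp (r * y^2) := by
          have : 0 ≤ r * y ^ 2 := by positivity
          linarith
        calc y ^ 4 = 2 / r ^ 2 * ((r * y^2)^2 / 2) := by field_simp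
          _ ≤ _ := by gcongr
    _ ≤ _ := by
        rw [lintegral_const_mul' _ _ (by simp)]
        gcongr

lemma gl_step {Ω : Type*} [MeasurableSpace Ω] {P : Measure Ω} [IsProbabilityMeasure P]
    {η : ℝ → Ω → ℝ} (hη : IsCenteredGaussianProcess P η) (s : ℝ) (N : ℕ) :
    ∫⁻ ω, glS η s (N+1) ω ∂P ≤ 125 * ∫⁻ ω, ENNReal.ofReal ((η (s + 2^N) ω - η s ω)^4) ∂P
      + ENNReal.ofReal (125/64) * (∫⁻ ω, glS η s N ω ∂P + ∫⁻ ω, glS η (s + 2^N) N ω ∂P) := by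
  have hm : Measurable fun ω => ENNReal.ofReal ((η (s + 2^N) ω - η s ω)^4) :=
    (((hη.1 _).sub (hη.1 _)).pow_const 4).ennreal_ofReal
  rw [← lintegral_add_left (glS_meas hη s N), ← lintegral_const_mul _ hm,
    ← lintegral_const_mul' _ _ (by simp), ← lintegral_add_left (hm.const_mul _)]
  refine lintegral_mono fun ω => iSup_le fun q => ?_
  have h64 : (1:ENNReal) ≤ ENNReal.ofReal (125/64) := by
    rw [← ENNReal.ofReal_one]; exact ENNReal.ofReal_le_ofReal (by norm_num)
  by_cases hq : q.1 ≤ 2 ^ N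
  · have h1 : ENNReal.ofReal ((η (s + (q.1:ℝ)) ω - η s ω) ^ 4) ≤ glS η s N ω :=
      le_iSup (fun q : glD N => ENNReal.ofReal ((η (s + (q.1:ℝ)) ω - η s ω) ^ 4)) ⟨q.1, q.2.1, hq⟩
    calc _ ≤ glS η s N ω := h1
      _ ≤ glS η s N ω + glS η (s+2^N) N ω := le_self_add
      _ ≤ ENNReal.ofReal (125/64) * (glS η s N ω + glS η (s+2^N) N ω) := le_mul_of_one_le_left' h64
      _ ≤ _ := le_add_self
  · push Not at hq
    set q' : glD N := ⟨q.1 - 2^N, by linarith, by have := q.2.2; have h2 := pow_succ (2:ℚ) N; linarith⟩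
    have h1 : ENNReal.ofReal ((η (s + 2^N + (q'.1:ℝ)) ω - η (s+2^N) ω) ^ 4) ≤ glS η (s+2^N) N ω :=
      le_iSup (fun q : glD N => ENNReal.ofReal ((η (s + 2^N + (q.1:ℝ)) ω - η (s+2^N) ω) ^ 4)) q'
    have e : s + 2^N + (q'.1:ℝ) = s + q.1 := by
      simp [q']
    rw [e] at h1
    set y := η (s + 2^N) ω - η s ω
    set d := η (s + (q.1:ℝ)) ω - η (s + 2^N) ω
    have e2 : η (s + (q.1:ℝ)) ω - η s ω = y + d := by simp [y, d]
    rw [e2]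
    have h4 : (y + d)^4 ≤ 125 * y^4 + 125/64 * d^4 := by
      have hsq : (y+d)^2 ≤ 5 * y^2 + 5/4 * d^2 := by nlinarith [sq_nonneg (2*y - d/2)]
      have h5 : (5 * y^2 + 5/4*d^2)^2 ≤ 125 * y^4 + 125/64*d^4 := by
        nlinarith [sq_nonneg (4*y^2 - d^2/4)]
      calc (y+d)^4 = ((y+d)^2)^2 := by ring
        _ ≤ (5 * y^2 + 5/4 * d^2)^2 := by gcongr
        _ ≤ _ := h5
    calc _ ≤ ENNReal.ofReal (125 * y^4 + 125/64 * d^4) := ENNReal.ofReal_le_ofReal h4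
      _ = 125 * ENNReal.ofReal (y^4) + ENNReal.ofReal (125/64) * ENNReal.ofReal (d^4) := by
          rw [ENNReal.ofReal_add (by positivity) (by positivity), ENNReal.ofReal_mul (by norm_num),
            ENNReal.ofReal_mul (by norm_num)]
          simp
      _ ≤ _ := by
          gcongr
          exact h1.trans le_add_self

lemma gl_moment {Ω : Type*} [MeasurableSpace Ω] {P : Measure Ω} [IsProbabilityMeasure P]
    {η : ℝ → Ω → ℝ} (hη : IsCenteredGaussianProcess P η) (f : ℝ → ℝ)
    (hf : ∀ x y : ℝ, ∫ ω, (η x ω - η y ω) ^ 2 ∂P = f (x - y))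
    (hc : ∀ᵐ ω ∂P, Continuous fun x => η x ω) (C : ℝ) (hfC : ∀ x, f x ≤ C * (|x| + 1)) :
    ∃ B : ℝ, 0 < B ∧ ∀ N s, ∫⁻ ω, glS η s N ω ∂P ≤ ENNReal.ofReal (B * 4 ^ N) := by
  obtain ⟨B0, hB0, hB⟩ := gl_base hη f hf hc
  set κ := ∫⁻ x, ENNReal.ofReal (x ^ 4) ∂(ProbabilityTheory.gaussianReal 0 1) with hκ
  have hκt : κ ≠ ⊤ := gl_kappa
  set k := κ.toReal with hk
  have hk0 : 0 ≤ k := ENNReal.toReal_nonneg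
  set B := B0.toReal + 6000 * C ^ 2 * k + 1 with hBd
  have hB0n : 0 ≤ B0.toReal := ENNReal.toReal_nonneg
  have hBpos : 0 < B := by positivity
  refine ⟨B, hBpos, ?_⟩
  intro N
  induction N with
  | zero =>
    intro s
    refine (hB s).trans ?_
    rw [← ENNReal.ofReal_toReal hB0]
    refine ENNReal.ofReal_le_ofReal ?_
    have : 0 ≤ 6000 * C^2 * k := by positivity
    simp only [pow_zero, mul_one]
    linarith
  | succ N ih =>
    intro s
    refine (gl_step hη s N).trans ?_
    have h4 : ∫⁻ ω, ENNReal.ofReal ((η (s + 2^N) ω - η s ω)^4) ∂P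
        ≤ ENNReal.ofReal (4 * C^2 * 4^N * k) := by
      obtain ⟨v, hv⟩ := gl_inc_gauss1 hη s (2^N)
      have hX : Measurable (fun ω => η (s + 2^N) ω - η s ω) := (hη.1 _).sub (hη.1 _)
      rw [gl_fourth hX hv, ← hκ, ← ENNReal.ofReal_toReal hκt, ← hk,
        ← ENNReal.ofReal_mul (by positivity)]
      refine ENNReal.ofReal_le_ofReal ?_
      gcongr
      have hv2 : (v:ℝ) ≤ C * (2^N + 1) := by
        have h1 := gl_var hX hv
        rw [hf] at h1
        rw [← h1]
        refine (hfC _).trans (le_of_eq ?_)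
        rw [add_sub_cancel_left, abs_of_pos (by positivity)]
      have h1N : (1:ℝ) ≤ 2^N := one_le_pow₀ (by norm_num)
      have hC0 : 0 ≤ C := by
        have := v.coe_nonneg.trans hv2
        by_contra hneg
        push Not at hneg
        nlinarith
      calc (v:ℝ)^2 ≤ (C * (2^N + 1))^2 := by gcongr
        _ ≤ (C * (2 * 2^N))^2 := by gcongr; linarith
        _ = 4 * C^2 * 4^N := by
          rw [show (4:ℝ)^N = (2^N)^2 by rw [← pow_mul, mul_comm, pow_mul]; norm_num]; ring
    calc _ ≤ 125 * ENNReal.ofReal (4 * C^2 * 4^N * k) + ENNReal.ofReal (125/64) *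
          (ENNReal.ofReal (B * 4^N) + ENNReal.ofReal (B * 4^N)) := by
          gcongr
          · exact ih s
          · exact ih _
      _ = ENNReal.ofReal (125 * (4 * C^2 * 4^N * k) + 125/64 * (B * 4^N + B * 4^N)) := by
          rw [ENNReal.ofReal_add (by positivity) (by positivity), ENNReal.ofReal_mul (p := 125) (by norm_num),
            ENNReal.ofReal_mul (p := 125/64) (by norm_num),
            ENNReal.ofReal_add (by positivity) (by positivity)]
          simp
      _ ≤ _ := by
          refine ENNReal.ofReal_le_ofReal ?_
          have h6 : 6000 * C^2 * k ≤ B := by linarith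
          have : 500 * C^2 * k + 125/32 * B ≤ 4 * B := by linarith
          have h4N : (0:ℝ) ≤ 4^N := by positivity
          calc _ = (500 * C^2 * k + 125/32 * B) * 4^N := by ring
            _ ≤ (4 * B) * 4^N := by gcongr
            _ = _ := by ring

lemma gl_exp {Ω : Type*} [MeasurableSpace Ω] {P : Measure Ω} [IsProbabilityMeasure P]
    {η : ℝ → Ω → ℝ} (hη : IsCenteredGaussianProcess P η) (f : ℝ → ℝ)
    (hf : ∀ x y : ℝ, ∫ ω, (η x ω - η y ω) ^ 2 ∂P = f (x - y))
    (hc : ∀ᵐ ω ∂P, Continuous fun x => η x ω) (C : ℝ) (hfC : ∀ x, f x ≤ C * (|x| + 1)) :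
    ∃ r : ℝ, 0 < r ∧ ∀ N s, ∫⁻ ω, ⨆ q : glD N,
      ENNReal.ofReal (Real.exp (r / 2 ^ N * (η (s + (q.1:ℝ)) ω - η s ω) ^ 2)) ∂P ≤ glC := by
  obtain ⟨B, hB, hBN⟩ := gl_moment hη f hf hc C hfC
  set A := 10 * B + 1 with hA
  have hγ := glγ_pos
  refine ⟨glγ * A⁻¹ ^ 2, by positivity, fun N s => ?_⟩
  have hne := glD_nonempty N
  set a := A * Real.sqrt (2^N) with ha
  have ha0 : 0 < a := by positivity
  have ha2 : a ^ 2 = A^2 * 2^N := by rw [ha, mul_pow, Real.sq_sqrt (by positivity)]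
  have ha4 : 10 * B * 4^N ≤ a ^ 4 := by
    have : a^4 = A^4 * 4^N := by
      rw [show a^4 = (a^2)^2 by ring, ha2, show (4:ℝ)^N = (2^N)^2 by
        rw [← pow_mul, mul_comm, pow_mul]; norm_num]; ring
    rw [this]
    gcongr
    have h1 : 1 ≤ A := by linarith
    have : A ≤ A^4 := le_self_pow₀ h1 (by norm_num)
    linarith
  have hq : 9/10 ≤ P {ω | ∀ q : glD N, |η (s + (q.1:ℝ)) ω - η s ω| ≤ a} := by
    have hbad : P {ω | ENNReal.ofReal (a^4) ≤ glS η s N ω} ≤ 1/10 := by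
      refine (meas_ge_le_lintegral_div (glS_meas hη s N).aemeasurable (by
        simp only [ne_eq, ENNReal.ofReal_eq_zero, not_le]; positivity) (by simp)).trans ?_
      refine ENNReal.div_le_of_le_mul ((hBN N s).trans ?_)
      rw [show (1/10 : ENNReal) = ENNReal.ofReal (1/10) by
        rw [ENNReal.ofReal_div_of_pos (by norm_num)]; simp, ← ENNReal.ofReal_mul (by norm_num)]
      exact ENNReal.ofReal_le_ofReal (by linarith)
    have hmb : MeasurableSet {ω | ENNReal.ofReal (a^4) ≤ glS η s N ω} :=
      measurableSet_le measurable_const (glS_meas hη s N)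
    have hcompl : 9/10 ≤ P {ω | ENNReal.ofReal (a^4) ≤ glS η s N ω}ᶜ := by
      rw [prob_compl_eq_one_sub hmb]
      refine le_trans (le_of_eq ?_) (tsub_le_tsub_left hbad 1)
      symm
      refine ENNReal.sub_eq_of_eq_add (ENNReal.div_ne_top (by simp) (by simp)) ?_
      rw [← ENNReal.add_div, eq_comm]
      norm_num
      exact ENNReal.div_self (by simp) (by simp)
    refine hcompl.trans (measure_mono fun ω hω q => ?_)
    rw [mem_compl_iff, mem_ofPred_eq, not_le] at hω
    have h1 : ENNReal.ofReal ((η (s + (q.1:ℝ)) ω - η s ω) ^ 4) < ENNReal.ofReal (a^4) :=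
      lt_of_le_of_lt (le_iSup (fun q : glD N =>
        ENNReal.ofReal ((η (s + (q.1:ℝ)) ω - η s ω) ^ 4)) q) hω
    have h2 := (ENNReal.ofReal_lt_ofReal_iff (by positivity)).1 h1
    rw [← Even.pow_abs (by decide)] at h2
    exact (lt_of_pow_lt_pow_left₀ 4 ha0.le h2).le
  have := gl_fernique P (fun (q : glD N) ω => η (s + (q.1:ℝ)) ω - η s ω)
    (fun q => (hη.1 _).sub (hη.1 _)) (fun n k c => gl_inc_gauss hη s n c _) a ha0.le hq
  have e : glγ * a⁻¹ ^ 2 = glγ * A⁻¹ ^ 2 / 2 ^ N := by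
    rw [inv_pow, ha2]; field_simp
  rwa [e] at this

lemma gl_final {Ω : Type*} [MeasurableSpace Ω] {P : Measure Ω} [IsProbabilityMeasure P]
    {η : ℝ → Ω → ℝ} (hη : IsCenteredGaussianProcess P η) (hη0 : ∀ ω, η 0 ω = 0) (f : ℝ → ℝ)
    (hf : ∀ x y : ℝ, ∫ ω, (η x ω - η y ω) ^ 2 ∂P = f (x - y))
    (hc : ∀ᵐ ω ∂P, Continuous fun x => η x ω) (C : ℝ) (hfC : ∀ x, f x ≤ C * (|x| + 1))
    (c : ℝ) (hcpos : 0 < c) (hfc : ∀ x, 0 < x → c * x ≤ f x) :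
    ∃ K c₀ c₁ c₂ c₃ : ℝ, 0 < K ∧ 0 < c₀ ∧ 0 < c₁ ∧ 0 < c₂ ∧ 0 < c₃ ∧
      ∀ h : ℝ, K < h →
        (∫ ω, sSup ((fun x => |η x ω|) '' {x : ℝ | |x| ≤ h}) ∂P
            ≤ c₀ * Real.sqrt (sSup (f '' {x : ℝ | |x| ≤ h}))) ∧
        ∀ u : ℝ, c₃ * Real.sqrt (f h) ≤ u →
          P {ω | u < sSup ((fun x => |η x ω|) '' {x : ℝ | |x| ≤ h})}
            ≤ ENNReal.ofReal (c₁ * Real.exp (-(u ^ 2) / (c₂ * sSup (f '' {x : ℝ | |x| ≤ h})))) := by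
  obtain ⟨r, hr, hexp⟩ := gl_exp hη f hf hc C hfC
  set g := glC.toReal with hg
  have hg0 : 0 ≤ g := ENNReal.toReal_nonneg
  refine ⟨1, Real.sqrt (16 / (r * c)) * (g + 1), g + 1, 16 / (r * c), 1, one_pos, by positivity,
    by positivity, by positivity, one_pos, fun h hh => ?_⟩
  have hh0 : 0 < h := by linarith
  set H := sSup (f '' {x : ℝ | |x| ≤ h}) with hH
  have hHh : c * h ≤ H := by
    refine (hfc h hh0).trans (le_csSup ⟨|C| * (h + 1), ?_⟩ ⟨h, by simp [abs_of_pos hh0], rfl⟩)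
    rintro _ ⟨x, hx, rfl⟩
    have hx' : |x| ≤ h := hx
    refine (hfC x).trans ?_
    have : 0 ≤ |x| + 1 := by positivity
    calc C * (|x| + 1) ≤ |C| * (|x| + 1) := by gcongr; exact le_abs_self C
      _ ≤ _ := by gcongr
  have hHpos : 0 < H := lt_of_lt_of_le (by positivity) hHh
  obtain ⟨n, hn1, hn2⟩ := exists_nat_pow_near hh.le (one_lt_two (α := ℝ))
  set M : ℝ := 2 ^ (n+1) with hM
  have hM2 : M ≤ 2 * h := by rw [hM, pow_succ]; linarith
  set G : Ω → ENNReal := fun ω => ⨆ q : glD (n+2),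
      ENNReal.ofReal (Real.exp (r / 2 ^ (n+2) * (η (-M + (q.1:ℝ)) ω - η (-M) ω) ^ 2)) with hG
  have hGint : ∫⁻ ω, G ω ∂P ≤ glC := hexp (n+2) (-M)
  have hGm : Measurable G := by
    refine Measurable.iSup fun q => ?_
    exact (((((hη.1 _).sub (hη.1 _)).pow_const 2).const_mul _).exp).ennreal_ofReal
  have hGt : ∀ᵐ ω ∂P, G ω < ⊤ :=
    ae_lt_top hGm (lt_of_le_of_lt hGint (lt_top_iff_ne_top.2 glC_ne_top)).ne
  set ρ : ℝ := r / 2^(n+2) with hρ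
  have hρ4 : r / (4 * h) ≤ ρ := by
    rw [hρ]
    gcongr
    rw [show (2:ℝ)^(n+2) = 2 * M by rw [hM]; ring]; linarith
  have hρpos : 0 < ρ := by positivity
  have hkey : ∀ᵐ ω ∂P, ∀ x, |x| ≤ h →
      ENNReal.ofReal (Real.exp (r / (16 * h) * (η x ω)^2)) ≤ G ω := by
    filter_upwards [hc] with ω hω
    have h1 : ∀ x, |x| ≤ M → ENNReal.ofReal (Real.exp (ρ * (η x ω - η (-M) ω)^2)) ≤ G ω := by
      intro x hx
      have hMpos : 0 < M := by positivity
      have hcl : IsClosed {y : ℝ | ENNReal.ofReal (Real.exp (ρ * (η (-M + y) ω - η (-M) ω)^2)) ≤ G ω} := by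
        refine isClosed_le ?_ continuous_const
        exact ENNReal.continuous_ofReal.comp (by fun_prop)
      have hsub : ((Rat.cast : ℚ → ℝ) '' {q | 0 ≤ q ∧ q ≤ 2^(n+2)}) ⊆
          {y : ℝ | ENNReal.ofReal (Real.exp (ρ * (η (-M + y) ω - η (-M) ω)^2)) ≤ G ω} := by
        rintro _ ⟨q, hq, rfl⟩
        exact le_iSup (fun q : glD (n+2) => 
          ENNReal.ofReal (Real.exp (ρ * (η (-M + (q.1:ℝ)) ω - η (-M) ω) ^ 2))) ⟨q, hq⟩
      have hcl2 : Icc (0:ℝ) (2^(n+2)) ⊆ closure ((Rat.cast : ℚ → ℝ) '' {q | 0 ≤ q ∧ q ≤ 2^(n+2)}) := by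
        have h0 : (0:ℝ) ≠ 2^(n+2) := by positivity
        rw [← closure_Ioo h0]
        refine closure_minimal ?_ isClosed_closure
        have hd : DenseRange (Rat.cast : ℚ → ℝ) := Rat.denseRange_cast
        refine (hd.open_subset_closure_inter isOpen_Ioo).trans (closure_mono ?_)
        rintro _ ⟨⟨hq1, hq2⟩, ⟨q, rfl⟩⟩
        refine ⟨q, ⟨by exact_mod_cast hq1.le, by exact_mod_cast hq2.le⟩, rfl⟩
      have := (closure_minimal hsub hcl) (hcl2 (show x + M ∈ Icc (0:ℝ) (2^(n+2)) by
        rw [show (2:ℝ)^(n+2) = 2 * M by rw [hM]; ring]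
        rw [abs_le] at hx
        constructor <;> linarith))
      rw [mem_ofPred_eq, show -M + (x + M) = x by ring] at this
      exact this
    intro x hx
    have hA := h1 x (by linarith)
    have hB := h1 0 (by rw [abs_zero]; positivity)
    rw [hη0] at hB
    set A := η x ω - η (-M) ω
    set B := 0 - η (-M) ω
    have hx : η x ω = A - B := by simp [A, B]
    have hr16 : r / (16 * h) = r / (4*h) / 4 := by field_simp; norm_num
    have hr0 : 0 ≤ r / (4 * h) := by positivity
    rcases le_total (A^2) (B^2) with hAB | hAB
    · refine le_trans (ENNReal.ofReal_le_ofReal (Real.exp_le_exp.2 ?_)) hB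
      calc r / (16 * h) * (η x ω)^2 ≤ r / (4*h) * B^2 := by
            rw [hx, hr16, div_mul_eq_mul_div, mul_div_assoc]
            gcongr; nlinarith [sq_nonneg (A+B)]
        _ ≤ _ := by gcongr
    · refine le_trans (ENNReal.ofReal_le_ofReal (Real.exp_le_exp.2 ?_)) hA
      calc r / (16 * h) * (η x ω)^2 ≤ r / (4*h) * A^2 := by
            rw [hx, hr16, div_mul_eq_mul_div, mul_div_assoc]
            gcongr; nlinarith [sq_nonneg (A+B)]
        _ ≤ _ := by gcongr
  have hne : ∀ ω, ((fun x => |η x ω|) '' {x : ℝ | |x| ≤ h}).Nonempty := fun ω =>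
    ⟨_, 0, by simp [hh0.le], rfl⟩
  constructor
  · have hGi : Integrable (fun ω => (G ω).toReal) P :=
      integrable_toReal_of_lintegral_ne_top hGm.aemeasurable
        (lt_of_le_of_lt hGint (lt_top_iff_ne_top.2 glC_ne_top)).ne
    have hbound : ∀ᵐ ω ∂P, sSup ((fun x => |η x ω|) '' {x : ℝ | |x| ≤ h}) ≤
        Real.sqrt (16 * h / r) * (G ω).toReal := by
      filter_upwards [hkey, hGt] with ω h1 h2
      refine csSup_le (hne ω) ?_
      rintro _ ⟨x, hx, rfl⟩
      have h3 := (ENNReal.ofReal_le_iff_le_toReal h2.ne).1 (h1 x hx)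
      have hs : 0 < Real.sqrt (16 * h / r) := Real.sqrt_pos.2 (by positivity)
      set t := |η x ω| / Real.sqrt (16 * h / r) with ht
      have e1 : |η x ω| = Real.sqrt (16 * h / r) * t := by rw [ht]; field_simp
      have e2 : r / (16 * h) * (η x ω)^2 = t^2 := by
        rw [ht, div_pow, sq_abs, Real.sq_sqrt (by positivity)]; field_simp
      rw [e2] at h3
      show |η x ω| ≤ _
      rw [e1]
      gcongr
      have := Real.add_one_le_exp (t^2)
      nlinarith [sq_nonneg (t - 1)]
    have h1 : ∫ ω, sSup ((fun x => |η x ω|) '' {x : ℝ | |x| ≤ h}) ∂P ≤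
        ∫ ω, Real.sqrt (16 * h / r) * (G ω).toReal ∂P := by
      refine integral_mono_of_nonneg (Eventually.of_forall fun ω => ?_) (hGi.const_mul _) hbound
      refine Real.sSup_nonneg ?_
      rintro _ ⟨x, _, rfl⟩
      exact abs_nonneg _
    refine h1.trans ?_
    rw [integral_const_mul, integral_toReal hGm.aemeasurable hGt]
    have h2 : (∫⁻ ω, G ω ∂P).toReal ≤ g + 1 :=
      (ENNReal.toReal_mono glC_ne_top hGint).trans (by linarith)
    have h3 : Real.sqrt (16 * h / r) ≤ Real.sqrt (16 / (r * c)) * Real.sqrt H := by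
      rw [← Real.sqrt_mul (by positivity)]
      refine Real.sqrt_le_sqrt ?_
      calc 16 * h / r = 16 / (r * c) * (c * h) := by field_simp
        _ ≤ _ := by gcongr
    calc _ ≤ (Real.sqrt (16 / (r * c)) * Real.sqrt H) * (g + 1) := by gcongr
      _ = _ := by ring
  · intro u hu
    have hu0 : 0 ≤ u := le_trans (by positivity) hu
    have h1 : P {ω | u < sSup ((fun x => |η x ω|) '' {x : ℝ | |x| ≤ h})} ≤
        P {ω | ENNReal.ofReal (Real.exp (r / (16 * h) * u^2)) ≤ G ω} := by
      refine measure_mono_ae ?_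
      filter_upwards [hkey] with ω h1 h2
      obtain ⟨_, ⟨x, hx, rfl⟩, hux⟩ := exists_lt_of_lt_csSup (hne ω) h2
      refine le_trans (ENNReal.ofReal_le_ofReal (Real.exp_le_exp.2 ?_)) (h1 x hx)
      rw [← sq_abs (η x ω)]
      gcongr
    refine h1.trans ((meas_ge_le_lintegral_div hGm.aemeasurable (by
      simp only [ne_eq, ENNReal.ofReal_eq_zero, not_le]; positivity) (by simp)).trans ?_)
    refine ENNReal.div_le_of_le_mul (hGint.trans ?_)
    rw [← ENNReal.ofReal_toReal glC_ne_top, ← hg, ← ENNReal.ofReal_mul (by positivity)]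
    refine ENNReal.ofReal_le_ofReal ?_
    rw [mul_assoc, ← Real.exp_add]
    have h2 : 0 ≤ -u^2 / (16 / (r * c) * H) + r / (16 * h) * u^2 := by
      have : u^2 / (16 / (r*c) * H) ≤ r / (16 * h) * u^2 := by
        calc u^2 / (16 / (r*c) * H) ≤ u^2 / (16 / (r*c) * (c * h)) := by gcongr
          _ = _ := by field_simp
      rw [neg_div]; linarith
    have h3 := Real.one_le_exp h2
    nlinarith

lemma an_int_pos {f : ℝ → ℝ} {s : Set ℝ} (hs : MeasurableSet s) (hf : ∀ x ∈ s, 0 < f x)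
    (hv : 0 < volume s) (hi : IntegrableOn f s) : 0 < ∫ x in s, f x := by
  rw [setIntegral_pos_iff_support_of_nonneg_ae]
  · refine lt_of_lt_of_le hv (measure_mono fun x hx => ⟨(hf x hx).ne', hx⟩)
  · filter_upwards [ae_restrict_mem hs] with x hx using (hf x hx).le
  · exact hi

lemma an_tail {θ : ℝ → ℝ} (hθ : ThetaOK θ) {x : ℝ} (hx : 0 < x) :
    IntegrableOn (fun z => 1 / θ z) (Ioi x) := by
  obtain ⟨hm, hp, hi⟩ := hθ
  have h1 := (hi.mono_set (Ioi_subset_Ioi hx.le)).const_mul (1 / min 1 (x^2))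
  refine Integrable.mono' h1 (Measurable.aestronglyMeasurable (by fun_prop)) ?_
  filter_upwards [ae_restrict_mem measurableSet_Ioi] with z hz
  have hz' : x < z := hz
  have ht := hp z (hx.trans hz')
  have hmin : min 1 (x^2) ≤ min 1 (z^2) := by gcongr
  have hm0 : 0 < min 1 (x^2) := by positivity
  rw [Real.norm_of_nonneg (by positivity)]
  rw [div_mul_div_comm, one_mul, div_le_div_iff₀ ht (by positivity)]
  nlinarith

lemma an_M {w : ℝ → ℝ} (hw : Measurable w) (hp : ∀ x > 0, 0 < w x) {A : ℝ} (hA : 0 < A)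
    (hint : IntegrableOn w (Ioi A)) {a : ℝ} (ha : 1 < a)
    (h : ∀ x ≥ A, 2 * a * ∫ z in Ioi x, w z ≤ x * w x) :
    IntegrableOn (fun x => x^2 * w x) (Ioi A) := by
  have hB : ∀ B > A, IntegrableOn (fun x => x^2 * w x) (Ioc A B) := by
    intro B hB
    refine Integrable.mono' ((hint.mono_set Ioc_subset_Ioi_self).const_mul (B^2)) (by fun_prop) ?_
    filter_upwards [ae_restrict_mem measurableSet_Ioc] with z hz
    have hz0 : 0 < z := hA.trans hz.1
    have := hp z hz0
    rw [Real.norm_of_nonneg (by positivity)]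
    have := hz.2
    gcongr
  set I0 := ∫ z in Ioi A, w z with hI0
  have hI0' : 0 ≤ I0 := setIntegral_nonneg measurableSet_Ioi fun z hz => (hp z (hA.trans hz)).le
  set c := A^2 * I0 with hc
  have key : ∀ B > A, ∫ z in Ioc A B, z^2 * w z ≤ c / (1 - 1/a) := by
    intro B hAB
    have hnn : ∀ᵐ z ∂(volume.restrict (Ioc A B)), 0 ≤ z^2 * w z := by
      filter_upwards [ae_restrict_mem measurableSet_Ioc] with z hz
      have := hp z (hA.trans hz.1)
      positivity
    have e1 := ofReal_integral_eq_lintegral_ofReal (hB B hAB) hnn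
    set M := ∫ z in Ioc A B, z^2 * w z with hM
    have hM0 : 0 ≤ M := integral_nonneg_of_ae hnn
    let F : ℝ → ℝ → ENNReal := fun z t =>
      if t ≤ z then ENNReal.ofReal (2*t) * ENNReal.ofReal (w z) else 0
    have hF : Measurable (Function.uncurry F) := by
      refine Measurable.ite (measurableSet_le measurable_snd measurable_fst) ?_ measurable_const
      fun_prop
    have b1 : ∀ z ∈ Ioc A B, ENNReal.ofReal (z^2 * w z) ≤
        ENNReal.ofReal (A^2) * ENNReal.ofReal (w z) + ∫⁻ t in Ioc A B, F z t := by
      intro z hz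
      have hz0 : 0 < z := hA.trans hz.1
      have hwz := hp z hz0
      have : ∫⁻ t in Ioc A z, ENNReal.ofReal (2*t) = ENNReal.ofReal (z^2 - A^2) := by
        rw [← ofReal_integral_eq_lintegral_ofReal]
        · rw [← intervalIntegral.integral_of_le hz.1.le]
          congr 1
          rw [intervalIntegral.integral_const_mul, integral_id]; ring
        · exact (Continuous.integrableOn_Icc (by fun_prop)).mono_set Ioc_subset_Icc_self
        · filter_upwards [ae_restrict_mem measurableSet_Ioc] with t ht
          have : 0 < t := hA.trans ht.1
          simp only [Pi.zero_apply]; positivity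
      have h2 : ∫⁻ t in Ioc A z, ENNReal.ofReal (2*t) * ENNReal.ofReal (w z) ≤
          ∫⁻ t in Ioc A B, F z t := by
        rw [setLIntegral_congr_fun (g := F z) measurableSet_Ioc
          (fun t ht => by simp only [F]; rw [if_pos ht.2])]
        exact lintegral_mono_set (Ioc_subset_Ioc_right hz.2)
      rw [lintegral_mul_const _ (by fun_prop), this] at h2
      refine le_trans (le_of_eq ?_) (add_le_add_right h2 _)
      have hz2 : 0 ≤ z^2 - A^2 := by nlinarith [hz.1]
      rw [← ENNReal.ofReal_mul (by positivity), ← ENNReal.ofReal_mul hz2, ← ENNReal.ofReal_add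
        (by positivity) (by positivity)]
      congr 1; ring
    have b2 : ∀ t ∈ Ioc A B, ∫⁻ z in Ioc A B, F z t ≤
        ENNReal.ofReal (1/a) * ENNReal.ofReal (t^2 * w t) := by
      intro t ht
      have ht0 : 0 < t := hA.trans ht.1
      have hi : IntegrableOn w (Ioi t) := hint.mono_set (Ioi_subset_Ioi ht.1.le)
      have s1 : ∫⁻ z in Ioc A B, F z t ≤
          ∫⁻ z in Ici t, ENNReal.ofReal (2*t) * ENNReal.ofReal (w z) := by
        rw [← lintegral_indicator measurableSet_Ici]
        refine (lintegral_mono fun z => ?_).trans (setLIntegral_le_lintegral _ _)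
        simp only [F, indicator_apply, mem_Ici]
        exact le_rfl
      refine s1.trans ?_
      rw [lintegral_const_mul _ (by fun_prop), setLIntegral_congr Ioi_ae_eq_Ici.symm,
        ← ofReal_integral_eq_lintegral_ofReal hi, ← ENNReal.ofReal_mul (by positivity),
        ← ENNReal.ofReal_mul (by positivity)]
      · refine ENNReal.ofReal_le_ofReal ?_
        have := h t ht.1.le
        rw [one_div, inv_mul_eq_div, le_div_iff₀ (by positivity)]
        nlinarith
      · filter_upwards [ae_restrict_mem measurableSet_Ioi] with z hz
        exact (hp z (ht0.trans hz)).le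
    have b3 : ENNReal.ofReal M ≤ ENNReal.ofReal c + ENNReal.ofReal (1/a) * ENNReal.ofReal M := by
      calc ENNReal.ofReal M = ∫⁻ z in Ioc A B, ENNReal.ofReal (z^2 * w z) := e1
        _ ≤ ∫⁻ z in Ioc A B, (ENNReal.ofReal (A^2) * ENNReal.ofReal (w z)
            + ∫⁻ t in Ioc A B, F z t) := setLIntegral_mono' measurableSet_Ioc b1
        _ = (∫⁻ z in Ioc A B, ENNReal.ofReal (A^2) * ENNReal.ofReal (w z))
            + ∫⁻ z in Ioc A B, ∫⁻ t in Ioc A B, F z t := lintegral_add_left (by fun_prop) _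
        _ = (∫⁻ z in Ioc A B, ENNReal.ofReal (A^2) * ENNReal.ofReal (w z))
            + ∫⁻ t in Ioc A B, ∫⁻ z in Ioc A B, F z t := by
              rw [lintegral_lintegral_swap hF.aemeasurable]
        _ ≤ _ := by
          refine add_le_add ?_ ?_
          · refine (lintegral_mono_set Ioc_subset_Ioi_self).trans ?_
            rw [lintegral_const_mul _ (by fun_prop), ← ofReal_integral_eq_lintegral_ofReal hint,
              ← ENNReal.ofReal_mul (by positivity)]
            filter_upwards [ae_restrict_mem measurableSet_Ioi] with z hz
            exact (hp z (hA.trans hz)).le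
          · refine (setLIntegral_mono' measurableSet_Ioc b2).trans ?_
            rw [lintegral_const_mul _ (by fun_prop), e1]
    have hc0 : 0 ≤ c := by positivity
    rw [← ENNReal.ofReal_mul (by positivity), ← ENNReal.ofReal_add hc0 (by positivity),
      ENNReal.ofReal_le_ofReal_iff (by positivity)] at b3
    have ha' : 0 < 1 - 1/a := by
      have : 1/a < 1 := by rw [div_lt_one (by positivity)]; exact ha
      linarith
    rw [le_div_iff₀ ha']
    linarith
  refine integrableOn_Ioi_of_intervalIntegral_norm_bounded (c / (1 - 1/a)) A (l := atTop)
    (b := fun n : ℝ => max n (A+1)) (fun n => hB _ (by simp)) ?_ ?_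
  · exact tendsto_atTop_mono (fun n => le_max_left _ _) tendsto_id
  · refine Eventually.of_forall fun n => ?_
    have hlt : A < max n (A+1) := by simp
    rw [intervalIntegral.integral_of_le hlt.le]
    refine le_trans (le_of_eq ?_) (key _ hlt)
    refine setIntegral_congr_fun measurableSet_Ioc fun z hz => ?_
    have := hp z (hA.trans hz.1)
    exact Real.norm_of_nonneg (by positivity)

lemma an_m2 {θ : ℝ → ℝ} {bl bh : ℝ} (hθ : ThetaOK θ) (hC2 : CondC2 θ bl bh) :
    IntegrableOn (fun x => x^2 / θ x) (Ioi 0) := by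
  obtain ⟨h1, -, -, -, hl, -⟩ := hC2
  have hp : ∀ x > 0, 0 < ∫ z in Ioi x, 1 / θ z := fun x hx =>
    an_int_pos measurableSet_Ioi (fun z hz => one_div_pos.2 (hθ.2.1 z (lt_trans hx hz)))
      (by simp) (an_tail hθ hx)
  obtain ⟨a, ha1, ha2⟩ := exists_between h1
  have hev : ∀ᶠ x in atTop, a < (x / θ x) / piF θ (1 / x) := by
    refine eventually_lt_of_lt_liminf (by rw [hl]; exact ha2) ?_
    refine ⟨0, ?_⟩
    rw [eventually_map]
    filter_upwards [eventually_gt_atTop 0] with x hx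
    have := hp x hx
    have := hθ.2.1 x hx
    simp only [piF, one_div_one_div, ge_iff_le]
    positivity
  obtain ⟨A, hA⟩ := eventually_atTop.1 hev
  have hA' : 0 < max A 1 := by positivity
  have := an_M (w := fun z => 1 / θ z) (by have := hθ.1; fun_prop)
    (fun x hx => one_div_pos.2 (hθ.2.1 x hx)) hA' (an_tail hθ hA') ha1 (fun x hx => by
      have hx0 : 0 < x := lt_of_lt_of_le hA' hx
      have h2 := hA x ((le_max_left _ _).trans hx)
      have h3 := hp x hx0
      simp only [piF, one_div_one_div] at h2
      rw [lt_div_iff₀ (by positivity)] at h2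
      rw [mul_one_div]
      linarith)
  have hm := hθ.1
  rw [← Ioc_union_Ioi_eq_Ioi hA'.le]
  refine IntegrableOn.union ?_ (this.congr_fun (fun x _ => by ring) measurableSet_Ioi)
  refine Integrable.mono' ((hθ.2.2.mono_set Ioc_subset_Ioi_self).const_mul ((max A 1)^2))
    (Measurable.aestronglyMeasurable (by fun_prop)) ?_
  filter_upwards [ae_restrict_mem measurableSet_Ioc] with z hz
  have ht := hθ.2.1 z hz.1
  rw [Real.norm_of_nonneg (by positivity), mul_div_assoc']
  gcongr
  have hz0 := hz.1
  have hz2 := hz.2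
  have h1 : 1 ≤ max A 1 := le_max_right _ _
  rcases le_total 1 (z^2) with hh | hh
  · rw [min_eq_left hh, mul_one]; gcongr
  · rw [min_eq_right hh]
    exact le_mul_of_one_le_left (sq_nonneg z) (one_le_pow₀ h1)

lemma an_cos_up (y : ℝ) : 1 - Real.cos y ≤ y^2 / 2 := by
  have := Real.one_sub_sq_div_two_le_cos (x := y); linarith

lemma an_cos_nn (y : ℝ) : 0 ≤ 1 - Real.cos y := by
  have := Real.cos_le_one y; linarith

lemma an_cos_low {y : ℝ} (h0 : 0 ≤ y) (h1 : y ≤ 1) : 2 / Real.pi^2 * y^2 ≤ 1 - Real.cos y := by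
  have := Real.cos_le_one_sub_mul_cos_sq (x := y) (by
    rw [abs_of_nonneg h0]; linarith [Real.pi_gt_three])
  linarith

lemma an_psi_int {θ : ℝ → ℝ} (hθ : ThetaOK θ) (h2 : IntegrableOn (fun x => x^2 / θ x) (Ioi 0))
    (l : ℝ) : IntegrableOn (fun x => (1 - Real.cos (x * l)) / θ x) (Ioi 0) := by
  have hm := hθ.1
  refine Integrable.mono' (h2.const_mul (l^2/2)) (Measurable.aestronglyMeasurable (by fun_prop)) ?_
  filter_upwards [ae_restrict_mem measurableSet_Ioi] with z hz
  have ht := hθ.2.1 z hz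
  have := an_cos_nn (z * l)
  have h3 := an_cos_up (z * l)
  rw [Real.norm_of_nonneg (by positivity), mul_div_assoc']
  gcongr
  linarith [mul_pow z l 2]

lemma an_psi_up {θ : ℝ → ℝ} (hθ : ThetaOK θ) (h2 : IntegrableOn (fun x => x^2 / θ x) (Ioi 0))
    (l : ℝ) : psiF θ l ≤ (∫ x in Ioi 0, x^2 / θ x) / 2 * l^2 := by
  have : (∫ x in Ioi 0, x^2 / θ x) / 2 * l^2 = ∫ x in Ioi 0, (l^2/2) * (x^2 / θ x) := by
    rw [integral_const_mul]; ring
  rw [this]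
  refine setIntegral_mono_on (an_psi_int hθ h2 l) (h2.const_mul _) measurableSet_Ioi ?_
  intro z hz
  have ht := hθ.2.1 z hz
  have h3 := an_cos_up (z * l)
  rw [mul_div_assoc']
  gcongr
  linarith [mul_pow z l 2]

lemma an_psi_low {θ : ℝ → ℝ} (hθ : ThetaOK θ) (h2 : IntegrableOn (fun x => x^2 / θ x) (Ioi 0))
    {L : ℝ} (hL : 0 < L) : ∃ c > 0, ∀ l, 0 < l → l ≤ L → c * l^2 ≤ psiF θ l := by
  have hpos : 0 < ∫ x in Ioc 0 (1/L), x^2 / θ x := by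
    refine an_int_pos measurableSet_Ioc (fun z hz => ?_) ?_ (h2.mono_set Ioc_subset_Ioi_self)
    · have := hθ.2.1 z hz.1
      have := hz.1
      positivity
    · simp [hL]
  refine ⟨2 / Real.pi^2 * ∫ x in Ioc 0 (1/L), x^2 / θ x, by positivity, fun l hl hlL => ?_⟩
  have e : (2 / Real.pi^2 * ∫ x in Ioc 0 (1/L), x^2 / θ x) * l^2
      = ∫ x in Ioc 0 (1/L), (2 / Real.pi^2 * l^2) * (x^2 / θ x) := by
    rw [integral_const_mul]; ring
  rw [e]
  have hi := an_psi_int hθ h2 l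
  refine le_trans (setIntegral_mono_on ((h2.mono_set Ioc_subset_Ioi_self).const_mul _)
    (hi.mono_set Ioc_subset_Ioi_self) measurableSet_Ioc ?_)
    (setIntegral_mono_set hi ?_ (Eventually.of_forall Ioc_subset_Ioi_self))
  · intro z hz
    have ht := hθ.2.1 z hz.1
    have hz0 := hz.1
    have h3 := an_cos_low (y := z * l) (by positivity) (by
      calc z * l ≤ 1/L * L := by gcongr; exact hz.2
        _ = 1 := by field_simp)
    rw [mul_div_assoc']
    gcongr
    linarith [mul_pow z l 2]
  · filter_upwards [ae_restrict_mem measurableSet_Ioi] with z hz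
    have ht := hθ.2.1 z hz
    exact div_nonneg (an_cos_nn _) ht.le

lemma an_psi_nn {θ : ℝ → ℝ} (hθ : ThetaOK θ) (l : ℝ) : 0 ≤ psiF θ l :=
  setIntegral_nonneg measurableSet_Ioi fun z hz => div_nonneg (an_cos_nn _) (hθ.2.1 z hz).le

lemma an_psi_meas {θ : ℝ → ℝ} (hθ : ThetaOK θ) : Measurable (psiF θ) := by
  have hm := hθ.1
  have : StronglyMeasurable (fun p : ℝ × ℝ => (1 - Real.cos (p.2 * p.1)) / θ p.2) :=
    Measurable.stronglyMeasurable (by fun_prop)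
  exact (this.integral_prod_right' (ν := volume.restrict (Ioi 0))).measurable

lemma an_main {θ : ℝ → ℝ} {bl bh : ℝ} (hθ : ThetaOK θ) (hψ : PsiIntegrable θ)
    (hC2 : CondC2 θ bl bh) : ∃ c C : ℝ, 0 < c ∧ (∀ x, sigma0sq θ x ≤ C * (|x| + 1)) ∧
      (∀ x, 0 < x → c * x ≤ sigma0sq θ x) := by
  have h2 := an_m2 hθ hC2
  have hmψ := an_psi_meas hθ
  have hψn := an_psi_nn hθ
  obtain ⟨c', hc', hlow⟩ := an_psi_low hθ h2 one_pos
  have hψp : ∀ l, 0 < l → 0 < psiF θ l := by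
    intro l hl
    obtain ⟨c, hc, h⟩ := an_psi_low hθ h2 hl
    exact lt_of_lt_of_le (by positivity) (h l hl le_rfl)
  set m2 := ∫ x in Ioi 0, x^2 / θ x with hm2
  have hm2p : 0 < m2 := an_int_pos measurableSet_Ioi (fun z hz => by
    have h1 := hθ.2.1 z hz
    have h3 : 0 < z := hz
    positivity) (by simp) h2
  have hgnn : ∀ x l, 0 ≤ (1 - Real.cos (l * x)) / psiF θ l := fun x l =>
    div_nonneg (an_cos_nn _) (hψn l)
  -- pointwise bound near zero
  have hp1 : ∀ x l, 0 < l → l ≤ 1 → (1 - Real.cos (l * x)) / psiF θ l ≤ x^2 / (2 * c') := by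
    intro x l hl hl1
    have a1 := hlow l hl hl1
    have a2 := an_cos_up (l * x)
    calc (1 - Real.cos (l * x)) / psiF θ l ≤ ((l*x)^2/2) / (c' * l^2) := by gcongr
      _ = _ := by field_simp
  have hp2 : ∀ x l, 0 < l → l ≤ 1 →
      (1 - Real.cos (l * x)) / psiF θ l ≤ (2 / c') * l ^ (-2 : ℝ) := by
    intro x l hl hl1
    have a1 := hlow l hl hl1
    have a2 : 1 - Real.cos (l * x) ≤ 2 := by linarith [Real.neg_one_le_cos (l * x)]
    calc (1 - Real.cos (l * x)) / psiF θ l ≤ 2 / (c' * l^2) := by gcongr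
      _ = _ := by rw [Real.rpow_neg hl.le, Real.rpow_two]; field_simp
  have hp3 : ∀ x l, (1 - Real.cos (l * x)) / psiF θ l ≤ 2 * (1 / psiF θ l) := by
    intro x l
    rw [mul_one_div]
    have := hψn l
    gcongr
    linarith [Real.neg_one_le_cos (l * x)]
  have hi1 : ∀ x, IntegrableOn (fun l => (1 - Real.cos (l * x)) / psiF θ l) (Ioc 0 1) := by
    intro x
    refine Integrable.mono' (g := fun _ => x^2 / (2 * c')) (by simp)
      (Measurable.aestronglyMeasurable (by fun_prop)) ?_
    filter_upwards [ae_restrict_mem measurableSet_Ioc] with l hl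
    rw [Real.norm_of_nonneg (hgnn x l)]
    exact hp1 x l hl.1 hl.2
  have hi2 : ∀ x, IntegrableOn (fun l => (1 - Real.cos (l * x)) / psiF θ l) (Ioi 1) := by
    intro x
    refine Integrable.mono' (hψ.const_mul 2) (Measurable.aestronglyMeasurable (by fun_prop)) ?_
    refine Eventually.of_forall fun l => ?_
    rw [Real.norm_of_nonneg (hgnn x l)]
    exact hp3 x l
  have hi : ∀ x, IntegrableOn (fun l => (1 - Real.cos (l * x)) / psiF θ l) (Ioi 0) := by
    intro x
    rw [← Ioc_union_Ioi_eq_Ioi (zero_le_one' ℝ)]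
    exact (hi1 x).union (hi2 x)
  set D := ∫ l in Ioi 1, 2 * (1 / psiF θ l) with hD
  have hD0 : 0 ≤ D := setIntegral_nonneg measurableSet_Ioi fun l _ => by
    have := hψn l
    positivity
  have hpi := Real.pi_pos
  refine ⟨8 / (Real.pi^3 * m2), 2 / Real.pi * (1 / (2*c') + 2 / c' + D), by positivity, ?_, ?_⟩
  · intro x
    set y := |x| + 1 with hy
    have hy1 : 1 ≤ y := by have := abs_nonneg x; linarith
    have hy0 : 0 < y := by linarith
    have hyi : 1 / y ≤ 1 := by rw [div_le_one hy0]; exact hy1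
    have hxy : x^2 ≤ y^2 := by
      rw [← sq_abs x]
      have := abs_nonneg x
      gcongr
      linarith
    unfold sigma0sq
    rw [mul_assoc]
    refine mul_le_mul_of_nonneg_left ?_ (by positivity)
    rw [← Ioc_union_Ioi_eq_Ioi (zero_le_one' ℝ),
      setIntegral_union (Ioc_disjoint_Ioi le_rfl) measurableSet_Ioi (hi1 x) (hi2 x),
      ← Ioc_union_Ioc_eq_Ioc (by positivity : 0 ≤ 1 / y) hyi,
      setIntegral_union (Ioc_disjoint_Ioc_of_le le_rfl) measurableSet_Ioc
        ((hi1 x).mono_set (Ioc_subset_Ioc_right hyi))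
        ((hi1 x).mono_set (Ioc_subset_Ioc_left (by positivity)))]
    have t1 : ∫ l in Ioc 0 (1/y), (1 - Real.cos (l * x)) / psiF θ l ≤ 1 / (2*c') * y := by
      have := setIntegral_mono_on (g := fun _ => y^2 / (2*c'))
        ((hi1 x).mono_set (Ioc_subset_Ioc_right hyi)) (by simp) measurableSet_Ioc
        (fun l hl => (hp1 x l hl.1 (hl.2.trans hyi)).trans (by gcongr))
      refine this.trans (le_of_eq ?_)
      rw [setIntegral_const, Real.volume_real_Ioc_of_le (by positivity), smul_eq_mul]
      field_simp
      ring
    have t2 : ∫ l in Ioc (1/y) 1, (1 - Real.cos (l * x)) / psiF θ l ≤ 2 / c' * y := by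
      have hyp : 0 < 1 / y := by positivity
      have hir : IntegrableOn (fun l : ℝ => (2 / c') * l ^ (-2 : ℝ)) (Ioi (1/y)) := (integrableOn_Ioi_rpow_of_lt (a := -2) (by norm_num) hyp).const_mul (2/c')
      have := setIntegral_mono_on (g := fun l => (2 / c') * l ^ (-2 : ℝ))
        ((hi1 x).mono_set (Ioc_subset_Ioc_left hyp.le))
        (hir.mono_set Ioc_subset_Ioi_self) measurableSet_Ioc
        (fun l hl => hp2 x l (hyp.trans hl.1) hl.2)
      refine this.trans ((setIntegral_mono_set hir ?_
        (Eventually.of_forall Ioc_subset_Ioi_self)).trans (le_of_eq ?_))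
      · filter_upwards [ae_restrict_mem measurableSet_Ioi] with l hl
        have : 0 < l := hyp.trans hl
        simp only [Pi.zero_apply]
        positivity
      · rw [integral_const_mul, integral_Ioi_rpow_of_lt (by norm_num) hyp]
        have : (-2 : ℝ) + 1 = -1 := by norm_num
        rw [this, Real.rpow_neg_one]
        simp
    have t3 : ∫ l in Ioi 1, (1 - Real.cos (l * x)) / psiF θ l ≤ D :=
      setIntegral_mono (hi2 x) (hψ.const_mul 2) (hp3 x)
    nlinarith
  · intro x hx
    unfold sigma0sq
    have e : 8 / (Real.pi^3 * m2) * x = 2 / Real.pi * (4 * x / (Real.pi^2 * m2)) := by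
      field_simp
      ring
    rw [e]
    refine mul_le_mul_of_nonneg_left ?_ (by positivity)
    have hx1 : 0 < 1 / x := by positivity
    have s1 := setIntegral_mono_set (s := Ioc 0 (1/x)) (hi x) (Eventually.of_forall (hgnn x))
      (Eventually.of_forall Ioc_subset_Ioi_self)
    refine le_trans ?_ s1
    have s2 := setIntegral_mono_on (f := fun _ => 4 * x^2 / (Real.pi^2 * m2)) (by simp)
      ((hi x).mono_set Ioc_subset_Ioi_self) measurableSet_Ioc
      (fun l hl => by
        have hl0 := hl.1
        have a1 := hψp l hl.1
        have a2 := an_psi_up hθ h2 l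
        have a3 := an_cos_low (y := l * x) (by positivity) (by
          calc l * x ≤ 1/x * x := by gcongr; exact hl.2
            _ = 1 := by field_simp)
        have a4 := an_cos_nn (l * x)
        calc 4 * x^2 / (Real.pi^2 * m2) = (2 / Real.pi^2 * (l*x)^2) / (m2 / 2 * l^2) := by
              field_simp
              ring
          _ ≤ _ := by gcongr)
    refine le_trans (le_of_eq ?_) s2
    rw [setIntegral_const, Real.volume_real_Ioc_of_le hx1.le, smul_eq_mul]
    field_simp
    ring

/-- Lemma 3.2: under (C2), there exists K > 0 such that for all h > K the conclusion of
    Lemma 3.1 holds (with possibly different constants c₀, c₁, c₂, c₃). -/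
theorem gaussian_upper_tail_large (θ : ℝ → ℝ) (bl bh : ℝ)
    (hθ : ThetaOK θ) (hψ : PsiIntegrable θ) (hC2 : CondC2 θ bl bh)
    {Ω : Type*} [MeasurableSpace Ω] (P : MeasureTheory.Measure Ω)
    [MeasureTheory.IsProbabilityMeasure P]
    (η : ℝ → Ω → ℝ) (hη : AssocGaussianProcess P θ η) :
    ∃ K c₀ c₁ c₂ c₃ : ℝ, 0 < K ∧ 0 < c₀ ∧ 0 < c₁ ∧ 0 < c₂ ∧ 0 < c₃ ∧
      ∀ h : ℝ, K < h →
        (∫ ω, sSup ((fun x => |η x ω|) '' {x : ℝ | |x| ≤ h}) ∂P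
            ≤ c₀ * Real.sqrt (sigma0sqHat θ h)) ∧
        ∀ u : ℝ, c₃ * Real.sqrt (sigma0sq θ h) ≤ u →
          P {ω | u < sSup ((fun x => |η x ω|) '' {x : ℝ | |x| ≤ h})}
            ≤ ENNReal.ofReal (c₁ * Real.exp (-(u ^ 2) / (c₂ * sigma0sqHat θ h))) := by
  obtain ⟨c, C, hc, hC, hfc⟩ := an_main hθ hψ hC2
  exact gl_final hη.1 hη.2.1 (sigma0sq θ) hη.2.2.2.2 hη.2.2.2.1 C hC c hc hfc
end
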